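/- There exists an absolute constant C > 0 with the following property. Let Q be a positive integer and α = v/w a reduced rational number in (0,1) with w < Q^{1/2}, and set E(1−α) := ℓ(1−α) + (log w)². Then | (1/#F(Q)) · Σ_{x ∈ F_α^c(Q)} ℓ(x) − (1/#F(Q)) · Σ_{x ∈ F_α(Q)} ℓ(x) + (1 − 1/w²) log Q | ≤ C·E(1−α). -/

import Mathlib

/-- The Farey fractions of order `Q`: rationals in `[0,1]` with denominator at most `Q`. -/
def farey (Q : ℕ) : Finset ℚ :=
  (Finset.Icc 1 Q).biUnion fun w => (Finset.Icc 0 w).image fun v : ℕ => (v : ℚ) / (w : ℚ)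
/-- Auxiliary recursion: the number of partial quotients in the minus continued fraction
expansion of `c/d` (for `c > d ≥ 1`), i.e. the number of steps of the by-excess
Euclidean algorithm. -/
def mcfSteps (c d : ℕ) : ℕ :=
  if _h : d = 0 then 0
  else
    let r := d * ((c + d - 1) / d) - c
    if r = 0 then 1
    else 1 + mcfSteps d r
termination_by d
decreasing_by
  simp_wf
  have h1 : d * ((c + d - 1) / d) ≤ c + d - 1 := by
    rw [Nat.mul_comm]; exact Nat.div_mul_le_self _ _
  omega

/-- `ℓ(x)`: the number of partial quotients in the minus continued fraction expansion
`x = 1 - 1/(b₁ - 1/(b₂ - ⋯ - 1/bₙ))` of a rational `x ∈ (0,1]`.  Writing `x = a/b` in lowest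
terms, this is the length of the minus continued fraction expansion of `b/(b-a)`. -/
def ell (x : ℚ) : ℕ := mcfSteps x.den (x.den - x.num.toNat)

section Aux

/-- unimodular quadruples (p,q,p',q') with p/q < p'/q' adjacent in [0,1] -/
def UU (N : ℕ) : Finset (ℕ × ℕ × ℕ × ℕ) :=
  (Finset.range (N+1) ×ˢ Finset.range (N+1) ×ˢ Finset.range (N+1) ×ˢ Finset.range (N+1)).filter
    (fun u => u.2.2.1 * u.2.1 = u.1 * u.2.2.2 + 1 ∧ u.2.2.1 ≤ u.2.2.2)

lemma uni_facts {p q p' q' : ℕ} (h : p' * q = p * q' + 1) (h' : p' ≤ q') :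
    0 < q ∧ 0 < q' ∧ 0 < p' ∧ p < q := by
  have hq : 0 < q := by rcases Nat.eq_zero_or_pos q with h0 | h0; · simp [h0] at h
                        · exact h0
  have hp' : 0 < p' := by rcases Nat.eq_zero_or_pos p' with h0 | h0; · simp [h0] at h
                          · exact h0
  refine ⟨hq, by omega, hp', ?_⟩
  by_contra hc
  push Not at hc
  have := Nat.mul_le_mul hc h'
  nlinarith

lemma mem_UU {N p q p' q' : ℕ} : (p, q, p', q') ∈ UU N ↔
    q ≤ N ∧ q' ≤ N ∧ p' * q = p * q' + 1 ∧ p' ≤ q' := by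
  simp only [UU, Finset.mem_filter, Finset.mem_product, Finset.mem_range]
  constructor
  · rintro ⟨⟨h1, h2, h3, h4⟩, h5, h6⟩; exact ⟨by omega, by omega, h5, h6⟩
  · rintro ⟨h1, h2, h3, h4⟩
    have := uni_facts h3 h4
    refine ⟨⟨by omega, by omega, by omega, by omega⟩, h3, h4⟩

/-- `ff a b` = length for a/b -/
def ff (a b : ℕ) : ℕ := mcfSteps b (b - a)

lemma mcf_add (a d : ℕ) (hd : 0 < d) : mcfSteps (a + d) d = mcfSteps a d := by
  rw [mcfSteps, mcfSteps]
  have h1 : (a + d + d - 1) / d = (a + d - 1) / d + 1 := by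
    rw [show a + d + d - 1 = (a + d - 1) + d by omega, Nat.add_div_right _ hd]
  have h2 : d * ((a + d - 1) / d + 1) - (a + d) = d * ((a + d - 1) / d) - a := by
    rw [Nat.mul_add]; omega
  simp only [h1, h2]

lemma ff_lt {a b : ℕ} (ha : 0 < a) (h : 2 * a < b) : ff a b = 1 + ff a (b - a) := by
  unfold ff
  rw [mcfSteps]
  have h1 : (b + (b - a) - 1) / (b - a) = 2 := by
    apply Nat.div_eq_of_lt_le <;> omega
  simp only [h1]
  have h2 : (b - a) * 2 - b = b - a - a := by omega
  rw [h2, dif_neg (by omega), if_neg (by omega)]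

lemma ff_gt {a b : ℕ} (hab : a < b) (h : b < 2 * a) : ff a b = ff (2 * a - b) a := by
  unfold ff
  rw [show a - (2 * a - b) = b - a by omega]
  conv_lhs => rw [show b = a + (b - a) by omega]
  rw [show a + (b - a) - a = b - a by omega]
  exact mcf_add _ _ (by omega)

lemma ff_half {a : ℕ} (ha : 0 < a) : ff a (2 * a) = 1 := by
  unfold ff
  rw [show 2 * a - a = a by omega, mcfSteps]
  have h1 : (2 * a + a - 1) / a = 2 := by
    apply Nat.div_eq_of_lt_le <;> omega
  simp only [h1]
  rw [dif_neg (by omega), if_pos (by omega)]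

def LL (N a b : ℕ) : Finset (ℕ × ℕ × ℕ × ℕ) :=
  (UU N).filter (fun u => u.2.1 < u.2.2.2 ∧ u.1 * b < a * u.2.1 ∧ a * u.2.2.2 < u.2.2.1 * b)

def RR (N a b : ℕ) : Finset (ℕ × ℕ × ℕ × ℕ) :=
  (UU N).filter (fun u => u.2.2.2 < u.2.1 ∧ u.1 * b < a * u.2.1 ∧ a * u.2.2.2 < u.2.2.1 * b)

lemma mem_LL {N a b p q p' q' : ℕ} : (p, q, p', q') ∈ LL N a b ↔
    (q ≤ N ∧ q' ≤ N ∧ p' * q = p * q' + 1 ∧ p' ≤ q') ∧ q < q' ∧ p * b < a * q ∧ a * q' < p' * b := by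
  simp only [LL, Finset.mem_filter, mem_UU]

lemma mem_RR {N a b p q p' q' : ℕ} : (p, q, p', q') ∈ RR N a b ↔
    (q ≤ N ∧ q' ≤ N ∧ p' * q = p * q' + 1 ∧ p' ≤ q') ∧ q' < q ∧ p * b < a * q ∧ a * q' < p' * b := by
  simp only [RR, Finset.mem_filter, mem_UU]

/-- denominators of a straddling pair -/
lemma straddle_le {a b p q p' q' : ℕ} (h : p' * q = p * q' + 1) (h1 : p * b < a * q)
    (h2 : a * q' < p' * b) : q + q' ≤ b := by
  zify at *
  have e : (b:ℤ) = q * (p' * b - a * q') + q' * (a * q - p * b) := by linear_combination (-(b:ℤ)) * h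
  have : 0 < (p' * b - a * q' : ℤ) := by linarith
  have : 0 < (a * q - p * b : ℤ) := by linarith
  have hq : (0:ℤ) ≤ q := by positivity
  have hq' : (0:ℤ) ≤ q' := by positivity
  nlinarith

lemma uni_le {p q p' q' : ℕ} (h : p' * q = p * q' + 1) (h1 : q < q') : p ≤ p' := by
  by_contra hc
  push Not at hc
  have := Nat.mul_le_mul hc.le h1.le
  omega

lemma half_straddle {p q p' q' : ℕ} (h : p' * q = p * q' + 1) (h' : p' ≤ q') (h1 : p * 2 < q)
    (h2 : q' < p' * 2) : p = 0 ∧ q = 1 ∧ p' = 1 ∧ q' = 1 := by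
  have := straddle_le (a := 1) (b := 2) h (by omega) (by omega)
  have := uni_facts h h'
  have hp : p = 0 := by omega
  subst hp
  have hq : q = 1 := by omega
  have hq' : q' = 1 := by omega
  subst hq; subst hq'
  simp at h
  simp [h]

lemma LL_lt {a b N: ℕ} (ha : 0 < a) (h : 2 * a < b) (hN : b ≤ N) :
    (LL N a b).card = 1 + (LL N a (b - a)).card := by
  have key : LL N a b = insert (0,1,1,2)
      ((LL N a (b-a)).image (fun u => (u.1, u.2.1 + u.1, u.2.2.1, u.2.2.2 + u.2.2.1))) := by
    ext ⟨p, q, p', q'⟩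
    simp only [Finset.mem_insert, Finset.mem_image, Prod.exists, Prod.mk.injEq]
    constructor
    · intro hm
      rw [mem_LL] at hm
      obtain ⟨⟨h1, h2, h3, h4⟩, h5, h6, h7⟩ := hm
      obtain ⟨f1, f2, f3, f4⟩ := uni_facts h3 h4
      by_cases hs : (p = 0 ∧ q = 1 ∧ p' = 1 ∧ q' = 2)
      · left; exact hs
      right
      have hpq : p * 2 < q := by
        by_contra hc; push Not at hc
        have := Nat.mul_le_mul_left a hc
        have := Nat.mul_le_mul_left p h.le
        have : 0 < p := by omega
        nlinarith
      have hp'q' : 2 * p' ≤ q' := by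
        by_contra hc
        have := half_straddle h3 h4 hpq (by omega)
        omega
      have hpp' : p ≤ p' := uni_le h3 h5
      have hlt : q - p < q' - p' := by
        obtain ⟨δ, rfl⟩ : ∃ δ, q' = q + 1 + δ := ⟨q' - q - 1, by omega⟩
        obtain ⟨ε, rfl⟩ : ∃ ε, p' = p + ε := ⟨p' - p, by omega⟩
        obtain ⟨s, rfl⟩ : ∃ s, q = p + 1 + s := ⟨q - p - 1, by omega⟩
        have e1 : ε * (p + 1 + s) = p * (1 + δ) + 1 := by nlinarith
        by_contra hc
        have hc : δ + 1 ≤ ε := by omega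
        have := Nat.mul_le_mul_right (p+1+s) hc
        have : (δ+1)*(1+s) ≤ 1 := by nlinarith
        have hs0 : s = 0 := by nlinarith
        have hd0 : δ = 0 := by nlinarith
        subst hs0; subst hd0
        have hp0 : p = 0 := by omega
        subst hp0
        simp at e1
        apply hs; omega
      refine ⟨p, q - p, p', q' - p', ?_, rfl, by omega, rfl, by omega⟩
      rw [mem_LL]
      refine ⟨⟨by omega, by omega, ?_, by omega⟩, hlt, ?_, ?_⟩
      · zify [f4.le, h4]; zify at h3; linear_combination h3
      · zify [f4.le, h4, (by omega : a ≤ b)]; zify at h6; linarith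
      · zify [f4.le, h4, (by omega : a ≤ b)]; zify at h7; linarith
    · rintro (⟨rfl, rfl, rfl, rfl⟩ | ⟨p0, q0, p0', q0', hm, rfl, rfl, rfl, rfl⟩)
      · rw [mem_LL]; omega
      · rw [mem_LL] at hm ⊢
        obtain ⟨⟨h1, h2, h3, h4⟩, h5, h6, h7⟩ := hm
        obtain ⟨f1, f2, f3, f4⟩ := uni_facts h3 h4
        have hb1 := straddle_le h3 h6 h7
        have h6' : p0 * b < a * (q0 + p0) := by
          zify [(by omega : a ≤ b)] at h6 ⊢; linarith
        have h7' : a * (q0' + p0') < p0' * b := by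
          zify [(by omega : a ≤ b)] at h7 ⊢; linarith
        have h3' : p0' * (q0 + p0) = p0 * (q0' + p0') + 1 := by linarith
        have hb := straddle_le h3' h6' h7'
        have hpp' : p0 ≤ p0' := uni_le h3 h5
        refine ⟨⟨by omega, by omega, h3', by omega⟩, by omega, h6', h7'⟩
  rw [key, Finset.card_insert_of_notMem, Finset.card_image_of_injOn]
  · omega
  · rintro ⟨p, q, p', q'⟩ _ ⟨r, s, r', s'⟩ _ h
    simp only [Prod.mk.injEq] at h ⊢
    omega
  · simp only [Finset.mem_image, Prod.exists, Prod.mk.injEq, not_exists, not_and]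
    intro p q p' q' hm
    rw [mem_LL] at hm
    omega

lemma LL_gt {a b N: ℕ} (hab : a < b) (h : b < 2 * a) (hN : b ≤ N) :
    (LL N a b).card = (LL N (2 * a - b) a).card := by
  have key : LL N a b = 
      ((LL N (2 * a - b) a).image (fun u => (u.2.1, 2 * u.2.1 - u.1, u.2.2.2, 2 * u.2.2.2 - u.2.2.1))) := by
    ext ⟨p, q, p', q'⟩
    simp only [Finset.mem_image, Prod.exists, Prod.mk.injEq]
    constructor
    · intro hm
      rw [mem_LL] at hm
      obtain ⟨⟨h1, h2, h3, h4⟩, h5, h6, h7⟩ := hm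
      obtain ⟨f1, f2, f3, f4⟩ := uni_facts h3 h4
      have hp'q' : q' < p' * 2 := by
        by_contra hc; push Not at hc
        have := Nat.mul_le_mul_left a hc
        have := Nat.mul_le_mul_left p' h.le
        nlinarith
      have hpq : q ≤ p * 2 := by
        by_contra hc
        have := half_straddle h3 h4 (by omega) hp'q'
        omega
      have hpp' : p < p' := by
        by_contra hc
        push Not at hc
        nlinarith
      refine ⟨2 * p - q, p, 2 * p' - q', p', ?_, rfl, by omega, rfl, by omega⟩
      rw [mem_LL]
      refine ⟨⟨by omega, by omega, ?_, by omega⟩, hpp', ?_, ?_⟩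
      · zify [hp'q'.le, hpq, (by omega : q ≤ 2 * p), (by omega : q' ≤ 2 * p')]; zify at h3; linear_combination h3
      · zify [(by omega : q ≤ 2 * p), (by omega : b ≤ 2 * a)]; zify at h6; linarith
      · zify [(by omega : q' ≤ 2 * p'), (by omega : b ≤ 2 * a)]; zify at h7; linarith
    · rintro ⟨p0, q0, p0', q0', hm, rfl, rfl, rfl, rfl⟩
      · rw [mem_LL] at hm ⊢
        obtain ⟨⟨h1, h2, h3, h4⟩, h5, h6, h7⟩ := hm
        obtain ⟨f1, f2, f3, f4⟩ := uni_facts h3 h4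
        have h6' : q0 * b < a * (2 * q0 - p0) := by
          zify [(by omega : b ≤ 2 * a), (by omega : p0 ≤ 2 * q0)] at h6 ⊢; linarith
        have h7' : a * (2 * q0' - p0') < q0' * b := by
          zify [(by omega : b ≤ 2 * a), (by omega : p0' ≤ 2 * q0')] at h7 ⊢; linarith
        have h3' : q0' * (2 * q0 - p0) = q0 * (2 * q0' - p0') + 1 := by
          zify [(by omega : p0 ≤ 2 * q0), (by omega : p0' ≤ 2 * q0')] at h3 ⊢; linarith
        have hb := straddle_le h3' h6' h7'
        have : 2 * q0 - p0 < 2 * q0' - p0' := by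
          obtain ⟨δ, rfl⟩ : ∃ δ, q0' = q0 + 1 + δ := ⟨q0' - q0 - 1, by omega⟩
          by_contra hc
          obtain ⟨ε, rfl⟩ : ∃ ε, p0' = p0 + 2 + 2 * δ + ε := ⟨p0' - p0 - 2 - 2 * δ, by omega⟩
          nlinarith
        refine ⟨⟨by omega, by omega, h3', by omega⟩, this, h6', h7'⟩
  rw [key, Finset.card_image_of_injOn]
  · rintro ⟨p, q, p', q'⟩ h1 ⟨r, s, r', s'⟩ h2 h
    simp only [Finset.mem_coe] at h1 h2
    rw [mem_LL] at h1 h2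
    have := uni_facts h1.1.2.2.1 h1.1.2.2.2
    have := uni_facts h2.1.2.2.1 h2.1.2.2.2
    simp only [Prod.mk.injEq] at h ⊢
    omega

theorem ff_eq_LL (N : ℕ) : ∀ b a : ℕ, 0 < a → a < b → b ≤ N → ff a b = 1 + (LL N a b).card := by
  intro b
  induction b using Nat.strong_induction_on with
  | _ b ih =>
    intro a ha hab hN
    rcases lt_trichotomy (2 * a) b with h | h | h
    · rw [ff_lt ha h, LL_lt ha h hN, ih (b - a) (by omega) a ha (by omega) (by omega)]
    · subst h
      rw [ff_half ha]
      have : LL N a (2 * a) = ∅ := by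
        ext ⟨p, q, p', q'⟩
        simp only [Finset.notMem_empty, iff_false]
        rw [mem_LL]
        rintro ⟨⟨h1, h2, h3, h4⟩, h5, h6, h7⟩
        have := half_straddle h3 h4 (by nlinarith) (by nlinarith)
        omega
      simp [this]
    · rw [ff_gt hab h, LL_gt hab h hN, ih a hab (2 * a - b) (by omega) (by omega) (by omega)]

theorem ff_eq_RR (N : ℕ) (b a : ℕ) (ha : 0 < a) (hab : a < b) (hN : b ≤ N) :
    ff (b - a) b = 1 + (RR N a b).card := by
  rw [ff_eq_LL N b (b - a) (by omega) (by omega) hN]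
  congr 1
  apply Finset.card_nbij' (fun u => (u.2.2.2 - u.2.2.1, u.2.2.2, u.2.1 - u.1, u.2.1))
    (fun u => (u.2.2.2 - u.2.2.1, u.2.2.2, u.2.1 - u.1, u.2.1))
  · rintro ⟨p, q, p', q'⟩ hm
    simp only [Finset.mem_coe] at hm ⊢
    rw [mem_LL] at hm
    rw [mem_RR]
    obtain ⟨⟨h1, h2, h3, h4⟩, h5, h6, h7⟩ := hm
    obtain ⟨f1, f2, f3, f4⟩ := uni_facts h3 h4
    zify [f4.le, h4, hab.le] at *
    refine ⟨⟨by omega, by omega, by linarith, by linarith⟩, h5, by linarith, by linarith⟩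
  · rintro ⟨p, q, p', q'⟩ hm
    simp only [Finset.mem_coe] at hm ⊢
    rw [mem_RR] at hm
    rw [mem_LL]
    obtain ⟨⟨h1, h2, h3, h4⟩, h5, h6, h7⟩ := hm
    obtain ⟨f1, f2, f3, f4⟩ := uni_facts h3 h4
    zify [f4.le, h4, hab.le] at *
    refine ⟨⟨by omega, by omega, by linarith, by linarith⟩, h5, by linarith, by linarith⟩
  · rintro ⟨p, q, p', q'⟩ hm
    simp only [Finset.mem_coe] at hm ⊢
    rw [mem_LL] at hm
    have := uni_facts hm.1.2.2.1 hm.1.2.2.2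
    simp only [Prod.mk.injEq, true_and, and_true]
    omega
  · rintro ⟨p, q, p', q'⟩ hm
    simp only [Finset.mem_coe] at hm ⊢
    rw [mem_RR] at hm
    have := uni_facts hm.1.2.2.1 hm.1.2.2.2
    simp only [Prod.mk.injEq, true_and, and_true]
    omega

open Finset

def MM (Q e d : ℕ) : ℕ :=
  ((Icc 1 Q ×ˢ Icc 1 Q).filter (fun x : ℕ × ℕ => x.1 * e + x.2 * d ≤ Q)).card

lemma MM_comm (Q e d : ℕ) : MM Q e d = MM Q d e := by
  unfold MM
  apply Finset.card_nbij' Prod.swap Prod.swap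
  · rintro ⟨m, n⟩ h; simp at h ⊢; omega
  · rintro ⟨m, n⟩ h; simp at h ⊢; omega
  · rintro ⟨m, n⟩ h; simp
  · rintro ⟨m, n⟩ h; simp

lemma MM_anti (Q d : ℕ) : Antitone (fun e => MM Q e d) := by
  intro e e' h
  apply Finset.card_le_card
  rintro ⟨m, n⟩ hm
  simp only [mem_filter] at hm ⊢
  refine ⟨hm.1, ?_⟩
  have := Nat.mul_le_mul_left m h
  omega

lemma MM_zero (Q e d : ℕ) (h : Q ≤ e) (hd : 0 < d) : MM Q e d = 0 := by
  unfold MM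
  rw [Finset.card_eq_zero, Finset.filter_eq_empty_iff]
  rintro ⟨m, n⟩ hm
  simp only [mem_product, mem_Icc] at hm
  have := Nat.mul_le_mul hm.1.1 h
  have := Nat.mul_le_mul hm.2.1 hd
  simp only
  omega

lemma MM_sum (Q e d : ℕ) (he : 0 < e) (hd : 0 < d) :
    MM Q e d = ∑ m ∈ Icc 1 (Q / e), (Q - m * e) / d := by
  unfold MM
  rw [Finset.card_filter, Finset.sum_product]
  have h1 : ∀ m ∈ Icc 1 Q, (∑ n ∈ Icc 1 Q, if m * e + n * d ≤ Q then 1 else 0) = (Q - m * e) / d := by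
    intro m hm
    rw [← Finset.card_filter]
    rw [mem_Icc] at hm
    rcases le_or_gt (m * e) Q with hle | hgt
    · have : (Icc 1 Q).filter (fun n => m * e + n * d ≤ Q) = Icc 1 ((Q - m * e) / d) := by
        ext n
        simp only [mem_filter, mem_Icc]
        rw [Nat.le_div_iff_mul_le hd]
        constructor
        · rintro ⟨⟨a, b⟩, c⟩; exact ⟨a, by omega⟩
        · rintro ⟨a, b⟩
          refine ⟨⟨a, ?_⟩, by omega⟩
          have := Nat.le_mul_of_pos_right n hd
          omega
      rw [this]; simp
    · rw [Nat.sub_eq_zero_of_le hgt.le, Nat.zero_div, Finset.card_eq_zero, Finset.filter_eq_empty_iff]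
      intro n _; omega
  rw [Finset.sum_congr rfl h1]
  symm
  apply Finset.sum_subset
  · intro m; simp only [mem_Icc]; rintro ⟨a, b⟩
    exact ⟨a, b.trans (Nat.div_le_self _ _)⟩
  · intro m h1 h2
    simp only [mem_Icc] at h1 h2
    have : Q < m * e := by
      rw [← Nat.div_lt_iff_lt_mul he]; omega
    rw [Nat.sub_eq_zero_of_le this.le, Nat.zero_div]

lemma sum_lin (Q e : ℝ) (K : ℕ) : ∑ m ∈ Icc 1 K, (Q - m * e) = K * Q - e * (K * (K + 1)) / 2 := by
  induction K with
  | zero => simp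
  | succ n ih => rw [Finset.sum_Icc_succ_top (by omega), ih]; push_cast; ring

lemma MM_upper (Q e d : ℕ) (he : 0 < e) (hd : 0 < d) :
    (MM Q e d : ℝ) ≤ (Q:ℝ)^2 / (2 * e * d) := by
  rw [MM_sum Q e d he hd]
  push_cast
  have he' : (0:ℝ) < e := by exact_mod_cast he
  have hd' : (0:ℝ) < d := by exact_mod_cast hd
  have : ∀ m ∈ Icc 1 (Q/e), (((Q - m * e) / d : ℕ) : ℝ) ≤ ((Q:ℝ) - m * e) / d := by
    intro m hm
    rw [mem_Icc, Nat.le_div_iff_mul_le he] at hm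
    refine Nat.cast_div_le.trans ?_
    rw [Nat.cast_sub hm.2]; push_cast; rfl
  refine (Finset.sum_le_sum this).trans ?_
  rw [← Finset.sum_div, sum_lin]
  set K : ℝ := ((Q/e : ℕ) : ℝ)
  have hK : 0 ≤ K := by positivity
  rw [div_le_div_iff₀ hd' (by positivity)]
  have h1 : (K * Q - e * (K * (K+1))/2) * (2 * e) ≤ (Q:ℝ)^2 := by
    nlinarith [sq_nonneg ((Q:ℝ) - K * e), mul_nonneg hK (mul_pos he' he').le]
  nlinarith

lemma MM_lower (Q e d : ℕ) (hd : 0 < d) (hde : d ≤ e) :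
    (Q:ℝ)^2 / (2 * e * d) - 2 * Q / d ≤ (MM Q e d : ℝ) := by
  have he : 0 < e := by omega
  have he' : (0:ℝ) < e := by exact_mod_cast he
  have hd' : (0:ℝ) < d := by exact_mod_cast hd
  have hde' : (d:ℝ) ≤ e := by exact_mod_cast hde
  have hQ : (0:ℝ) ≤ Q := by positivity
  rcases lt_or_ge Q e with hlt | hge
  · have hlt' : (Q:ℝ) < e := by exact_mod_cast hlt
    have : (Q:ℝ)^2 / (2 * e * d) ≤ 2 * (Q:ℝ) / d := by
      rw [div_le_div_iff₀ (by positivity) hd']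
      have : (Q:ℝ)^2 ≤ 2 * Q * (2 * e) := by nlinarith
      nlinarith
    have : (0:ℝ) ≤ MM Q e d := by positivity
    linarith
  rw [MM_sum Q e d he hd]
  push_cast
  have hge' : (e:ℝ) ≤ Q := by exact_mod_cast hge
  have : ∀ m ∈ Icc 1 (Q/e), ((Q:ℝ) - m * e) / d - 1 ≤ (((Q - m * e) / d : ℕ) : ℝ) := by
    intro m hm
    rw [mem_Icc, Nat.le_div_iff_mul_le he] at hm
    have h := Nat.lt_div_mul_add (a := Q - m * e) hd
    have h2 : ((Q - m * e : ℕ) : ℝ) < ((Q - m * e) / d : ℕ) * d + d := by exact_mod_cast h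
    rw [Nat.cast_sub hm.2] at h2
    push_cast at h2
    rw [sub_le_iff_le_add, div_le_iff₀ hd']
    linarith
  refine le_trans ?_ (Finset.sum_le_sum this)
  rw [Finset.sum_sub_distrib, ← Finset.sum_div, sum_lin]
  simp only [sum_const, Nat.card_Icc, nsmul_eq_mul, mul_one, Nat.add_sub_cancel]
  have hK1 : ((Q/e : ℕ) : ℝ) * e ≤ Q := by exact_mod_cast Nat.div_mul_le_self Q e
  have hK2 : (Q:ℝ) < ((Q/e : ℕ) : ℝ) * e + e := by exact_mod_cast Nat.lt_div_mul_add (a := Q) he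
  set K : ℝ := ((Q/e : ℕ) : ℝ)
  have hK : 0 ≤ K := by positivity
  rw [← sub_nonneg]
  have : (K * Q - e * (K * (K + 1)) / 2) / d - K - ((Q:ℝ) ^ 2 / (2 * e * d) - 2 * Q / d)
     = ((K * Q - e * (K * (K + 1)) / 2 - K * d + 2 * Q) * (2 * e) - Q^2) / (2 * e * d) := by
    field_simp
    ring
  rw [this]
  apply div_nonneg _ (by positivity)
  have h3 : ((Q:ℝ) - K * e)^2 ≤ e ^ 2 := by
    apply pow_le_pow_left₀ <;> linarith
  have h4 : K * d ≤ K * e := by gcongr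
  have h5 : (K*d) * e ≤ Q * e := by gcongr; linarith
  have h6 : K * e * e ≤ Q * e := by gcongr
  nlinarith

lemma MM_approx (Q e d : ℕ) (hd : 0 < d) (hde : d ≤ e) :
    |(MM Q e d : ℝ) - (Q:ℝ)^2 / (2 * e * d)| ≤ 2 * (Q:ℝ) / d := by
  rw [abs_le]
  have h1 := MM_lower Q e d hd hde
  have h2 := MM_upper Q e d (by omega) hd
  have : (0:ℝ) ≤ 2 * (Q:ℝ) / d := by positivity
  constructor <;> linarith

/-- pairs -/
def PP (Q v w : ℕ) : Finset (ℕ × ℕ) :=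
  (Icc 1 Q ×ˢ Icc 1 Q).filter (fun x : ℕ × ℕ => x.1 * w < v * x.2)

def CC (Q v w : ℕ) (u : ℕ × ℕ × ℕ × ℕ) : ℕ :=
  ((PP Q v w).filter (fun x : ℕ × ℕ => u.1 * x.2 < x.1 * u.2.1 ∧ x.1 * u.2.2.2 < u.2.2.1 * x.2)).card

noncomputable def SS (Q v w : ℕ) : ℝ := ∑ x ∈ PP Q v w, ((ff (x.2 - x.1) x.2 : ℝ) - ff x.1 x.2)

lemma mem_PP {Q v w a b : ℕ} : (a, b) ∈ PP Q v w ↔ ((1 ≤ a ∧ a ≤ Q) ∧ (1 ≤ b ∧ b ≤ Q)) ∧ a * w < v * b := by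
  simp [PP]

lemma PP_lt {Q v w a b : ℕ} (hvw : v < w) (h : (a,b) ∈ PP Q v w) : a < b := by
  rw [mem_PP] at h
  by_contra hc
  push Not at hc
  have := Nat.mul_le_mul hc hvw.le
  nlinarith [h.2]

lemma SS_eq (Q v w : ℕ) (hvw : v < w) : SS Q v w =
    ∑ u ∈ (UU Q).filter (fun u => u.2.2.2 < u.2.1), (CC Q v w u : ℝ)
    - ∑ u ∈ (UU Q).filter (fun u => u.2.1 < u.2.2.2), (CC Q v w u : ℝ) := by
  have h1 : SS Q v w = ∑ x ∈ PP Q v w, (((RR Q x.1 x.2).card : ℝ) - (LL Q x.1 x.2).card) := by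
    apply Finset.sum_congr rfl
    rintro ⟨a, b⟩ hx
    have hab := PP_lt hvw hx
    rw [mem_PP] at hx
    simp only
    rw [ff_eq_LL Q b a (by omega) hab (by omega), ff_eq_RR Q b a (by omega) hab (by omega)]
    push_cast; ring
  rw [h1, Finset.sum_sub_distrib]
  congr 1
  · unfold CC RR
    simp_rw [Finset.card_filter]
    push_cast
    rw [Finset.sum_filter, Finset.sum_comm]
    refine Finset.sum_congr rfl fun u _ => ?_
    split_ifs with h
    · simp [h]
    · simp [h]
  · unfold CC LL
    simp_rw [Finset.card_filter]
    push_cast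
    rw [Finset.sum_filter, Finset.sum_comm]
    refine Finset.sum_congr rfl fun u _ => ?_
    split_ifs with h
    · simp [h]
    · simp [h]

lemma CC_le {Q v w p q p' q' : ℕ} (h : p' * q = p * q' + 1) : CC Q v w (p,q,p',q') ≤ MM Q q q' := by
  unfold CC MM
  apply Finset.card_le_card_of_injOn (fun x => (p' * x.2 - q' * x.1, q * x.1 - p * x.2))
  · rintro ⟨a, b⟩ hx
    simp only [Finset.coe_filter, Set.mem_ofPred_eq, mem_PP] at hx
    obtain ⟨⟨hab, h0⟩, h1, h2⟩ := hx
    simp only [Finset.coe_filter, Set.mem_ofPred_eq, mem_product, mem_Icc]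
    have e : (p' * b - q' * a) * q + (q * a - p * b) * q' = b := by
      zify [(by linarith : q' * a ≤ p' * b), (by linarith : p * b ≤ q * a)]
      zify at h
      linear_combination (b:ℤ) * h
    have k1 : 1 ≤ p' * b - q' * a := by have : a * q' = q' * a := mul_comm _ _; omega
    have k2 : 1 ≤ q * a - p * b := by have : a * q = q * a := mul_comm _ _; omega
    have hq : 0 < q := by rcases Nat.eq_zero_or_pos q with h0 | h0; · simp [h0] at h
                          · exact h0
    have hb := straddle_le h h1 h2
    have hq' : 0 < q' ∨ q' = 0 := by omega
    rcases hq' with hq' | hq'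
    · have := Nat.le_mul_of_pos_right (p' * b - q' * a) hq
      have := Nat.le_mul_of_pos_right (q * a - p * b) hq'
      refine ⟨⟨⟨k1, by omega⟩, ⟨k2, by omega⟩⟩, by omega⟩
    · subst hq'
      have := Nat.eq_one_of_mul_eq_one_left (by simpa using h : p' * q = 1)
      subst this
      have := Nat.le_mul_of_pos_right (p' * b - 0 * a) hq
      refine ⟨⟨⟨k1, by omega⟩, ⟨k2, by omega⟩⟩, by omega⟩
  · rintro ⟨a, b⟩ hx ⟨c, d⟩ hy hxy
    simp only [Finset.coe_filter, Set.mem_ofPred_eq, mem_PP] at hx hy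
    simp only [Prod.mk.injEq] at hxy ⊢
    obtain ⟨_, h1, h2⟩ := hx
    obtain ⟨_, h3, h4⟩ := hy
    zify [(by linarith : q' * a ≤ p' * b), (by linarith : p * b ≤ q * a),
      (by linarith : q' * c ≤ p' * d), (by linarith : p * d ≤ q * c)] at hxy
    zify at h ⊢
    obtain ⟨x1, x2⟩ := hxy
    constructor
    · linear_combination p * x1 + p' * x2 - (a - c : ℤ) * h
    · linear_combination q * x1 + q' * x2 - (b - d : ℤ) * h

lemma CC_eq {Q v w p q p' q' : ℕ} (h : p' * q = p * q' + 1) (h' : p' ≤ q') (hvw : v < w)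
    (hy : p' * w ≤ v * q') : CC Q v w (p,q,p',q') = MM Q q q' := by
  apply le_antisymm (CC_le h)
  obtain ⟨f1, f2, f3, f4⟩ := uni_facts h h'
  unfold CC MM
  apply Finset.card_le_card_of_injOn (fun x => (x.1 * p + x.2 * p', x.1 * q + x.2 * q'))
  · rintro ⟨m, n⟩ hx
    simp only [Finset.coe_filter, Set.mem_ofPred_eq, mem_product, mem_Icc] at hx
    obtain ⟨⟨⟨m1, m2⟩, n1, n2⟩, hmn⟩ := hx
    simp only [Finset.coe_filter, Set.mem_ofPred_eq, mem_PP]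
    have k1 : n * p' ≤ n * q' := by gcongr
    have k2 : m * p ≤ m * q := by gcongr
    have k3 : 1 ≤ n * p' := Nat.mul_pos n1 f3
    refine ⟨⟨⟨⟨by omega, by omega⟩, by omega, by omega⟩, ?_⟩, ?_, ?_⟩
    · have : p * w < v * q := by
        by_contra hc
        push Not at hc
        have := Nat.mul_le_mul_right q hy
        have := Nat.mul_le_mul_right q' hc
        have : w * (p' * q) = w * (p * q' + 1) := by rw [h]
        nlinarith
      have := Nat.mul_lt_mul_of_pos_left this m1
      have := Nat.mul_le_mul_left n hy
      nlinarith
    · have : n * (p' * q) = n * (p * q' + 1) := by rw [h]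
      nlinarith
    · have : m * (p' * q) = m * (p * q' + 1) := by rw [h]
      nlinarith
  · rintro ⟨a, b⟩ hx ⟨c, d⟩ hy hxy
    simp only [Prod.mk.injEq] at hxy ⊢
    zify at hxy h ⊢
    obtain ⟨x1, x2⟩ := hxy
    constructor
    · linear_combination p' * x2 - q' * x1 - (a - c : ℤ) * h
    · linear_combination q * x1 - p * x2 - (b - d : ℤ) * h

lemma CC_zero {Q v w p q p' q' : ℕ} 
    (hy : v * q ≤ p * w) : CC Q v w (p,q,p',q') = 0 := by
  unfold CC
  rw [Finset.card_eq_zero, Finset.filter_eq_empty_iff]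
  rintro ⟨a, b⟩ hm
  rw [mem_PP] at hm
  rintro ⟨h1, -⟩
  simp only at h1
  obtain ⟨⟨⟨a1, a2⟩, b1, b2⟩, h2⟩ := hm
  rcases Nat.eq_zero_or_pos q with hq | hq
  · subst hq; omega
  have e1 := Nat.mul_lt_mul_of_pos_right h2 hq
  have e2 := Nat.mul_le_mul_right b hy
  have e3 := Nat.mul_le_mul_right w h1.le
  nlinarith


lemma UU_inj {N : ℕ} : Set.InjOn (fun u : ℕ × ℕ × ℕ × ℕ => (u.2.1, u.2.2.2)) (UU N : Set (ℕ × ℕ × ℕ × ℕ)) := by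
  rintro ⟨p, q, p', q'⟩ h1 ⟨r, s, r', s'⟩ h2 h
  simp only [Finset.mem_coe, mem_UU] at h1 h2
  simp only [Prod.mk.injEq] at h ⊢
  obtain ⟨rfl, rfl⟩ := h
  obtain ⟨_, _, a1, a2⟩ := h1
  obtain ⟨_, _, b1, b2⟩ := h2
  have fa := uni_facts a1 a2
  have fb := uni_facts b1 b2
  zify at a1 b1
  have hc : IsCoprime (q:ℤ) (q':ℤ) := ⟨p', -p, by linear_combination a1⟩
  have hd : (q:ℤ) ∣ (p - r) := by
    apply hc.dvd_of_dvd_mul_right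
    exact ⟨p' - r', by linear_combination b1 - a1⟩
  have : (p:ℤ) - r = 0 := by
    apply Int.eq_zero_of_abs_lt_dvd hd
    rw [abs_lt]; omega
  have hpr : p = r := by omega
  subst hpr
  refine ⟨rfl, rfl, ?_, rfl⟩
  have : (p':ℤ) * q = r' * q := by linarith
  have := mul_right_cancel₀ (by omega) this
  exact_mod_cast this

lemma UU_sum_le {N : ℕ} (s : Finset (ℕ × ℕ × ℕ × ℕ)) (hs : s ⊆ UU N) (T : Finset (ℕ × ℕ))
    (F : ℕ → ℕ → ℝ) (hF : ∀ x ∈ T, 0 ≤ F x.1 x.2) (hT : ∀ u ∈ s, (u.2.1, u.2.2.2) ∈ T) :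
    ∑ u ∈ s, F u.2.1 u.2.2.2 ≤ ∑ x ∈ T, F x.1 x.2 := by
  have inj : Set.InjOn (fun u : ℕ × ℕ × ℕ × ℕ => (u.2.1, u.2.2.2)) (s : Set (ℕ × ℕ × ℕ × ℕ)) :=
    UU_inj.mono (by exact_mod_cast hs)
  rw [← Finset.sum_image (s := s) (g := fun u : ℕ × ℕ × ℕ × ℕ => (u.2.1, u.2.2.2)) (f := fun x => F x.1 x.2) inj]
  apply Finset.sum_le_sum_of_subset_of_nonneg
  · intro x hx
    rw [mem_image] at hx
    obtain ⟨u, hu, rfl⟩ := hx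
    exact hT u hu
  · intro x hx _; exact hF x hx

lemma harm_le (n : ℕ) : ∑ i ∈ Icc 1 n, (1:ℝ) / i ≤ 1 + Real.log n := by
  have := harmonic_le_one_add_log n
  rw [harmonic_eq_sum_Icc] at this
  push_cast at this
  simpa [one_div] using this

lemma harm_ge (n : ℕ) : Real.log (n+1) ≤ ∑ i ∈ Icc 1 n, (1:ℝ) / i := by
  have := log_add_one_le_harmonic n
  rw [harmonic_eq_sum_Icc] at this
  push_cast at this
  simpa [one_div] using this

lemma straddle_sum (Q v w : ℕ) :
    ∑ u ∈ (UU Q).filter (fun u => u.1 * w < v * u.2.1 ∧ v * u.2.2.2 < u.2.2.1 * w), (MM Q u.2.1 u.2.2.2 : ℝ)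
    ≤ (Q:ℝ)^2 * (1 + Real.log w)^2 := by
  have h := UU_sum_le (N := Q) ((UU Q).filter (fun u => u.1 * w < v * u.2.1 ∧ v * u.2.2.2 < u.2.2.1 * w))
    (Finset.filter_subset _ _) (Icc 1 w ×ˢ Icc 1 w) (fun q q' => (MM Q q q' : ℝ))
    (by intros; positivity) (by
      rintro ⟨p, q, p', q'⟩ hu
      rw [mem_filter, mem_UU] at hu
      obtain ⟨⟨_, _, a1, a2⟩, h1, h2⟩ := hu
      have := straddle_le a1 h1 h2
      have := uni_facts a1 a2
      simp only [mem_product, mem_Icc]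
      omega)
  refine h.trans ?_
  have h2 : ∑ x ∈ Icc 1 w ×ˢ Icc 1 w, (MM Q x.1 x.2 : ℝ) ≤
      ∑ x ∈ Icc 1 w ×ˢ Icc 1 w, (Q:ℝ)^2 * (1 / (x.1:ℝ) * (1 / (x.2:ℝ))) := by
    apply Finset.sum_le_sum
    rintro ⟨e, d⟩ hx
    simp only [mem_product, mem_Icc] at hx
    refine (MM_upper Q e d (by omega) (by omega)).trans ?_
    have he : (0:ℝ) < e := by exact_mod_cast hx.1.1
    have hd : (0:ℝ) < d := by exact_mod_cast hx.2.1
    simp only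
    rw [div_mul_div_comm, one_mul, mul_one_div]
    apply div_le_div_of_nonneg_left (by positivity) (by positivity)
    nlinarith [mul_pos he hd]
  refine h2.trans ?_
  rw [← Finset.mul_sum, Finset.sum_product]
  simp only
  rw [← Finset.sum_mul_sum, ← sq]
  gcongr
  exact harm_le w

noncomputable def XA (Q v w : ℕ) (K : ℕ → ℕ → ℝ) : ℝ :=
  ∑ u ∈ (UU Q).filter (fun u => u.2.2.2 < u.2.1 ∧ u.2.2.1 * w ≤ v * u.2.2.2), K u.2.1 u.2.2.2
noncomputable def XB (Q v w : ℕ) (K : ℕ → ℕ → ℝ) : ℝ :=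
  ∑ u ∈ (UU Q).filter (fun u => u.2.1 < u.2.2.2 ∧ u.1 * w < v * u.2.1), K u.2.2.2 u.2.1

lemma uni_order {v w p q p' q' : ℕ} (hw : 0 < w) (h : p' * q = p * q' + 1) (h' : p' ≤ q') (hy : p' * w ≤ v * q') :
    p * w < v * q := by
  by_contra hc
  push Not at hc
  have := Nat.mul_le_mul_right q hy
  have := Nat.mul_le_mul_right q' hc
  have : w * (p' * q) = w * (p * q' + 1) := by rw [h]
  nlinarith

lemma SS_main (Q v w : ℕ) (hvw : v < w) :
    |SS Q v w - (XA Q v w (fun e d => MM Q e d) - XB Q v w (fun e d => MM Q e d))| ≤ 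
     (Q:ℝ)^2 * (1 + Real.log w)^2 := by
  refine le_trans ?_ (straddle_sum Q v w)
  rw [SS_eq Q v w hvw]
  unfold XA XB
  simp only [Finset.sum_filter]
  rw [← Finset.sum_sub_distrib, ← Finset.sum_sub_distrib, ← Finset.sum_sub_distrib]
  refine (Finset.abs_sum_le_sum_abs _ _).trans ?_
  apply Finset.sum_le_sum
  rintro ⟨p, q, p', q'⟩ hu
  rw [mem_UU] at hu
  obtain ⟨_, _, a1, a2⟩ := hu
  simp only
  rw [MM_comm Q q' q]
  have c0 : (0:ℝ) ≤ CC Q v w (p,q,p',q') := by positivity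
  have c1 : (CC Q v w (p,q,p',q') : ℝ) ≤ MM Q q q' := by exact_mod_cast CC_le a1
  by_cases b1 : p' * w ≤ v * q'
  · have b2 := uni_order (by omega) a1 a2 b1
    rw [CC_eq a1 a2 hvw b1]
    simp [b1, b2, not_lt.2 b1]
  · by_cases b2 : p * w < v * q
    · have b1' : v * q' < p' * w := by omega
      simp only [b1, b2, b1', and_false, and_true, if_false, if_true]
      rcases lt_trichotomy q q' with h | h | h
      · simp only [h, if_true, not_lt_of_gt h, if_false]
        rw [abs_le]; constructor <;> linarith
      · subst h; simp
      · simp only [h, if_true, not_lt_of_gt h, if_false]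
        rw [abs_le]; constructor <;> linarith
    · have b2' : v * q ≤ p * w := by omega
      rw [CC_zero b2']
      simp [b1, b2]

lemma XA_eq (Q v w : ℕ) (hvw : v < w) (K : ℕ → ℕ → ℝ) (hK : ∀ e d, Q < e → 0 < d → K e d = 0) :
    XA Q v w K = ∑ u ∈ (UU Q).filter (fun u => u.2.1 < u.2.2.2 ∧ u.2.2.1 * w ≤ v * u.2.2.2),
      ∑ k ∈ Icc 1 Q, K (u.2.1 + k * u.2.2.2) u.2.2.2 := by
  unfold XA
  rw [← Finset.sum_product', ← Finset.sum_filter_of_ne (s := _ ×ˢ _)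
    (p := fun x => x.1.2.1 + x.2 * x.1.2.2.2 ≤ Q)]
  · apply Finset.sum_nbij' 
      (fun u => ((u.1 - (u.2.1 / u.2.2.2) * u.2.2.1, u.2.1 % u.2.2.2, u.2.2.1, u.2.2.2), u.2.1 / u.2.2.2))
      (fun x => (x.1.1 + x.2 * x.1.2.2.1, x.1.2.1 + x.2 * x.1.2.2.2, x.1.2.2.1, x.1.2.2.2))
    · rintro ⟨p, q, p', q'⟩ hu
      rw [mem_filter, mem_UU] at hu
      obtain ⟨⟨h1, h2, a1, a2⟩, h3, h4⟩ := hu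
      simp only at h3 h4
      obtain ⟨f1, f2, f3, f4⟩ := uni_facts a1 a2
      have hmod := Nat.mod_add_div q q'
      have hlt := Nat.mod_lt q f2
      have hk : 1 ≤ q / q' := by rw [Nat.le_div_iff_mul_le f2]; omega
      set k := q / q'
      set r := q % q'
      have hp : k * p' ≤ p := by
        by_contra hc
        have hc : p + 1 ≤ k * p' := by omega
        have := Nat.mul_le_mul_right q' hc
        rw [← hmod] at a1
        have : q' = 1 := by nlinarith
        subst this
        have : p' = 1 := by omega
        subst this
        omega
      rw [← hmod] at a1
      simp only [mem_filter, mem_product, mem_UU, mem_Icc]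
      refine ⟨⟨⟨⟨by omega, h2, ?_, a2⟩, hlt, h4⟩, hk, (Nat.div_le_self _ _).trans h1⟩, ?_⟩
      · zify [hp] at a1 ⊢; linear_combination a1
      · rw [mul_comm, hmod]; exact h1
    · rintro ⟨⟨p, q, p', q'⟩, k⟩ hu
      simp only [mem_filter, mem_product, mem_UU, mem_Icc] at hu
      obtain ⟨⟨⟨⟨h1, h2, a1, a2⟩, h3, h4⟩, k1, k2⟩, h5⟩ := hu
      obtain ⟨f1, f2, f3, f4⟩ := uni_facts a1 a2
      rw [mem_filter, mem_UU]
      have := Nat.mul_le_mul_right q' k1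
      refine ⟨⟨h5, h2, by linarith, a2⟩, by simp only; omega, h4⟩
    · rintro ⟨p, q, p', q'⟩ hu
      rw [mem_filter, mem_UU] at hu
      obtain ⟨⟨h1, h2, a1, a2⟩, h3, h4⟩ := hu
      simp only at h3 h4
      obtain ⟨f1, f2, f3, f4⟩ := uni_facts a1 a2
      have hmod := Nat.mod_add_div q q'
      have hlt := Nat.mod_lt q f2
      simp only [Prod.mk.injEq, and_true]
      set k := q / q'
      set r := q % q'
      have hp : k * p' ≤ p := by
        by_contra hc
        have hc : p + 1 ≤ k * p' := by omega
        have := Nat.mul_le_mul_right q' hc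
        rw [← hmod] at a1
        have : q' = 1 := by nlinarith
        subst this
        have : p' = 1 := by omega
        subst this
        omega
      constructor
      · omega
      · rw [mul_comm k]; exact hmod
    · rintro ⟨⟨p, q, p', q'⟩, k⟩ hu
      simp only [mem_filter, mem_product, mem_UU, mem_Icc] at hu
      obtain ⟨⟨⟨⟨h1, h2, a1, a2⟩, h3, h4⟩, k1, k2⟩, h5⟩ := hu
      obtain ⟨f1, f2, f3, f4⟩ := uni_facts a1 a2
      have e1 : (q + k * q') / q' = k := by
        rw [Nat.add_mul_div_right _ _ f2, Nat.div_eq_of_lt h3]; omega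
      have e2 : (q + k * q') % q' = q := by
        rw [Nat.add_mul_mod_self_right, Nat.mod_eq_of_lt h3]
      simp only [e1, e2, Nat.add_sub_cancel]
    · rintro ⟨p, q, p', q'⟩ hu
      simp only
      rw [mul_comm (q / q'), Nat.mod_add_div]
  · rintro ⟨⟨p, q, p', q'⟩, k⟩ hu hne
    simp only [mem_filter, mem_product, mem_UU, mem_Icc] at hu
    obtain ⟨⟨⟨h1, h2, a1, a2⟩, h3, h4⟩, k1, k2⟩ := hu
    by_contra hc
    exact hne (hK _ _ (by simpa using hc) (by simp only; omega))

set_option maxHeartbeats 2000000 in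
lemma XB_eq (Q v w : ℕ) (hv : 0 < v) (hvw : v < w) (K : ℕ → ℕ → ℝ) (hK : ∀ e d, Q < e → 0 < d → K e d = 0) :
    XB Q v w K = ∑ e ∈ Icc 2 Q, K e 1 +
      ∑ u ∈ (UU Q).filter (fun u => u.2.1 < u.2.2.2 ∧ u.2.2.1 * w < v * u.2.2.2),
      ∑ k ∈ Icc 1 Q, K ((k + 1) * u.2.2.2 - u.2.1) u.2.2.2 := by
  unfold XB
  rw [← Finset.sum_filter_add_sum_filter_not _ (fun u => u.2.1 = 1)]
  congr 1
  · apply Finset.sum_nbij' (fun u => u.2.2.2) (fun e => (0, 1, 1, e))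
    · rintro ⟨p, q, p', q'⟩ hu
      simp only [mem_filter, mem_UU] at hu
      simp only [mem_Icc]
      omega
    · intro e he
      rw [mem_Icc] at he
      simp only [mem_filter, mem_UU]
      refine ⟨⟨⟨by omega, by omega, by simp, by omega⟩, by omega, by omega⟩, trivial⟩
    · rintro ⟨p, q, p', q'⟩ hu
      simp only [mem_filter, mem_UU] at hu
      obtain ⟨⟨⟨h1, h2, a1, a2⟩, h3, h4⟩, rfl⟩ := hu
      have := uni_facts a1 a2
      have : p = 0 := by omega
      subst this
      simp at a1
      simp [a1]
    · intro e he; rfl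
    · rintro ⟨p, q, p', q'⟩ hu
      simp only [mem_filter, mem_UU] at hu
      simp only [hu.2]
  rw [← Finset.sum_product', ← Finset.sum_filter_of_ne (s := _ ×ˢ _)
    (p := fun x => (x.2 + 1) * x.1.2.2.2 - x.1.2.1 ≤ Q)]
  · apply Finset.sum_nbij' 
      (fun u => (((u.2.2.2 / u.2.1 + 1) * u.1 - u.2.2.1, (u.2.2.2 / u.2.1 + 1) * u.2.1 - u.2.2.2, u.1, u.2.1), u.2.2.2 / u.2.1))
      (fun x => (x.1.2.2.1, x.1.2.2.2, (x.2 + 1) * x.1.2.2.1 - x.1.1, (x.2 + 1) * x.1.2.2.2 - x.1.2.1))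
    · rintro ⟨p, q, p', q'⟩ hu
      simp only [mem_filter, mem_UU] at hu
      obtain ⟨⟨⟨h1, h2, a1, a2⟩, h3, h4⟩, hq⟩ := hu
      obtain ⟨f1, f2, f3, f4⟩ := uni_facts a1 a2
      have hmod := Nat.mod_add_div q' q
      have hlt := Nat.mod_lt q' f1
      have hk : 1 ≤ q' / q := by rw [Nat.le_div_iff_mul_le f1]; omega
      have hr : 1 ≤ q' % q := by
        by_contra hc
        have : q ∣ q' := Nat.dvd_of_mod_eq_zero (by omega)
        obtain ⟨c, rfl⟩ := this
        have : q ∣ 1 := (Nat.dvd_add_right (Dvd.dvd.mul_left (Dvd.intro _ rfl) p)).1 (a1 ▸ Dvd.intro_left p' rfl)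
        exact hq (Nat.dvd_one.1 this)
      have hp0 : 1 ≤ p := by
        by_contra hc
        have : p = 0 := by omega
        subst this
        exact hq (Nat.eq_one_of_mul_eq_one_left (by simpa using a1))
      have hkq : q' / q ≤ Q := (Nat.div_le_self _ _).trans h2
      set k := q' / q
      set r := q' % q
      have hx : q' ≤ (k+1) * q := by rw [← hmod]; nlinarith
      have hx2 : (k+1) * q - q' < q := by rw [← hmod, Nat.add_mul, mul_comm q k]; omega
      have hp : p' ≤ (k + 1) * p := by
        by_contra hc
        have hc : (k+1) * p + 1 ≤ p' := by omega
        have := Nat.mul_le_mul_right q hc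
        have := Nat.mul_le_mul_left p hx
        have : q = 1 := by nlinarith
        exact hq this
      simp only [mem_filter, mem_product, mem_UU, mem_Icc]
      refine ⟨⟨⟨⟨by omega, h1, ?_, by omega⟩, hx2, h4⟩, hk, hkq⟩, ?_⟩
      · zify [hp, hx] at a1 ⊢; linear_combination a1
      · omega
    · rintro ⟨⟨p, q, p', q'⟩, k⟩ hu
      simp only [mem_filter, mem_product, mem_UU, mem_Icc] at hu
      obtain ⟨⟨⟨⟨h1, h2, a1, a2⟩, h3, h4⟩, k1, k2⟩, h5⟩ := hu
      obtain ⟨f1, f2, f3, f4⟩ := uni_facts a1 a2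
      simp only [mem_filter, mem_UU]
      have e1 : q ≤ (k+1) * q' := h3.le.trans (Nat.le_mul_of_pos_left _ (by omega))
      have e2 : p ≤ (k+1) * p' := (uni_le a1 h3).trans (Nat.le_mul_of_pos_left _ (by omega))
      have e3 : p' < q' := by
        rcases lt_or_eq_of_le a2 with h | h
        · exact h
        · subst h
          have : p' ∣ 1 := (Nat.dvd_add_right (Dvd.intro_left p rfl)).1 (a1 ▸ Dvd.intro _ rfl)
          have := Nat.dvd_one.1 this
          omega
      have e4 : 2 * q' ≤ (k+1) * q' := by gcongr; omega
      refine ⟨⟨⟨h2, h5, ?_, ?_⟩, by omega, h4⟩, by omega⟩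
      · zify [e1, e2] at a1 ⊢; linear_combination a1
      · zify [e1, e2]
        have g1 : (q:ℤ) - p ≤ q' - p' := by
          by_contra hc
          push Not at hc
          have hc : (q':ℤ) - p' + 1 ≤ q - p := by omega
          have := mul_le_mul_of_nonneg_right hc (by positivity : (0:ℤ) ≤ q')
          zify at a1 h3 e3
          have : ((q':ℤ) - p') * (q' - q) < 1 := by nlinarith
          have : (1:ℤ) ≤ ((q':ℤ) - p') * (q' - q) := by
            have h1 : (1:ℤ) ≤ q' - p' := by omega
            have h2 : (1:ℤ) ≤ q' - q := by omega
            nlinarith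
          omega
        have : (0:ℤ) ≤ k * ((q':ℤ) - p') := by
          apply mul_nonneg (by positivity); omega
        linarith
    · rintro ⟨p, q, p', q'⟩ hu
      simp only [mem_filter, mem_UU] at hu
      obtain ⟨⟨⟨h1, h2, a1, a2⟩, h3, h4⟩, hq⟩ := hu
      obtain ⟨f1, f2, f3, f4⟩ := uni_facts a1 a2
      have hmod := Nat.mod_add_div q' q
      have hlt := Nat.mod_lt q' f1
      have hp0 : 1 ≤ p := by
        by_contra hc
        have : p = 0 := by omega
        subst this
        exact hq (Nat.eq_one_of_mul_eq_one_left (by simpa using a1))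
      simp only [Prod.mk.injEq, true_and]
      set k := q' / q
      set r := q' % q
      have hx : q' ≤ (k+1) * q := by rw [← hmod]; nlinarith
      have hp : p' ≤ (k + 1) * p := by
        by_contra hc
        have hc : (k+1) * p + 1 ≤ p' := by omega
        have := Nat.mul_le_mul_right q hc
        have := Nat.mul_le_mul_left p hx
        have : q = 1 := by nlinarith
        exact hq this
      omega
    · rintro ⟨⟨p, q, p', q'⟩, k⟩ hu
      simp only [mem_filter, mem_product, mem_UU, mem_Icc] at hu
      obtain ⟨⟨⟨⟨h1, h2, a1, a2⟩, h3, h4⟩, k1, k2⟩, h5⟩ := hu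
      obtain ⟨f1, f2, f3, f4⟩ := uni_facts a1 a2
      have e0 : q ≤ (k+1) * q' := h3.le.trans (Nat.le_mul_of_pos_left _ (by omega))
      have e3 : p ≤ (k+1) * p' := (uni_le a1 h3).trans (Nat.le_mul_of_pos_left _ (by omega))
      have e1 : ((k+1) * q' - q) / q' = k := by
        apply Nat.div_eq_of_lt_le
        · rw [Nat.add_mul]; omega
        · rw [Nat.add_mul]; omega
      simp only [e1, Prod.mk.injEq, and_true, true_and]
      omega
    · rintro ⟨p, q, p', q'⟩ hu
      simp only [mem_filter, mem_UU] at hu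
      obtain ⟨⟨⟨h1, h2, a1, a2⟩, h3, h4⟩, hq⟩ := hu
      obtain ⟨f1, f2, f3, f4⟩ := uni_facts a1 a2
      have hmod := Nat.mod_add_div q' q
      have hlt := Nat.mod_lt q' f1
      have hx : q' ≤ (q' / q+1) * q := by rw [Nat.add_mul, mul_comm]; omega
      simp only
      congr 1
      omega
  · rintro ⟨⟨p, q, p', q'⟩, k⟩ hu hne
    simp only [mem_filter, mem_product, mem_UU, mem_Icc] at hu
    obtain ⟨⟨⟨h1, h2, a1, a2⟩, h3, h4⟩, k1, k2⟩ := hu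
    by_contra hc
    exact hne (hK _ _ (not_le.1 hc) (by simp only; omega))


def U0 (Q v w : ℕ) : Finset (ℕ × ℕ × ℕ × ℕ) :=
  (UU Q).filter (fun u => u.2.1 < u.2.2.2 ∧ u.2.2.1 * w < v * u.2.2.2)

lemma endpoint (v w : ℕ) (hv : 0 < v) (hvw : v < w) (hc : Nat.Coprime v w) :
    ∃ r, 0 < r ∧ r < w ∧ ∀ (Q : ℕ) (G : ℕ → ℕ → ℝ),
      ∑ u ∈ (UU Q).filter (fun u => u.2.1 < u.2.2.2 ∧ u.2.2.1 * w = v * u.2.2.2), G u.2.1 u.2.2.2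
       = if w ≤ Q then G r w else 0 := by
  obtain ⟨r, hr, hr1⟩ := Nat.exists_mul_mod_eq_one_of_coprime hc (by omega)
  have hr0 : 0 < r := by
    rcases Nat.eq_zero_or_pos r with h | h
    · subst h; simp at hr1
    · exact h
  have hdm := Nat.mod_add_div (v * r) w
  rw [hr1] at hdm
  set t := v * r / w
  refine ⟨r, hr0, hr, fun Q G => ?_⟩
  have key : ∀ p q p' q' : ℕ, (p,q,p',q') ∈ (UU Q).filter (fun u => u.2.1 < u.2.2.2 ∧ u.2.2.1 * w = v * u.2.2.2) →
      p = t ∧ q = r ∧ p' = v ∧ q' = w := by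
    intro p q p' q' hu
    simp only [mem_filter, mem_UU] at hu
    obtain ⟨⟨h1, h2, a1, a2⟩, h3, h4⟩ := hu
    obtain ⟨f1, f2, f3, f4⟩ := uni_facts a1 a2
    have cop : Nat.Coprime p' q' := by
      have : IsCoprime (p':ℤ) (q':ℤ) := ⟨q, -p, by zify at a1; linear_combination a1⟩
      exact Nat.isCoprime_iff_coprime.1 this
    have d1 : p' ∣ v := cop.dvd_of_dvd_mul_right (h4 ▸ Dvd.intro _ rfl)
    have d2 : v ∣ p' := hc.dvd_of_dvd_mul_right (h4 ▸ Dvd.intro _ rfl)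
    have e1 : p' = v := Nat.dvd_antisymm d1 d2
    subst e1
    have e2 : q' = w := (Nat.eq_of_mul_eq_mul_left f3 h4).symm
    subst e2
    have : ((q':ℕ):ℤ) ∣ (q:ℤ) - r := by
      apply (Nat.isCoprime_iff_coprime.2 cop).symm.dvd_of_dvd_mul_left
      zify at a1 hdm
      exact ⟨p - t, by linear_combination a1 + hdm⟩
    have : (q:ℤ) - r = 0 := by
      apply Int.eq_zero_of_abs_lt_dvd this
      rw [abs_lt]; omega
    have hqr : q = r := by omega
    subst hqr
    refine ⟨?_, rfl, rfl, rfl⟩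
    apply Nat.eq_of_mul_eq_mul_right f2
    rw [mul_comm t]; omega
  split_ifs with hwQ
  · have : (UU Q).filter (fun u => u.2.1 < u.2.2.2 ∧ u.2.2.1 * w = v * u.2.2.2) = {(t, r, v, w)} := by
      ext ⟨p, q, p', q'⟩
      constructor
      · intro h
        obtain ⟨rfl, rfl, rfl, rfl⟩ := key _ _ _ _ h
        simp
      · intro h
        simp only [mem_singleton, Prod.mk.injEq] at h
        obtain ⟨rfl, rfl, rfl, rfl⟩ := h
        simp only [mem_filter, mem_UU]
        refine ⟨⟨by omega, hwQ, by rw [mul_comm t]; omega, hvw.le⟩, hr, trivial⟩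
    rw [this, sum_singleton]
  · apply Finset.sum_eq_zero
    rintro ⟨p, q, p', q'⟩ h
    obtain ⟨rfl, rfl, rfl, rfl⟩ := key _ _ _ _ h
    simp only [mem_filter, mem_UU] at h
    omega

lemma XAB (v w : ℕ) (hv : 0 < v) (hvw : v < w) (hc : Nat.Coprime v w) :
    ∃ r, 0 < r ∧ r < w ∧ ∀ (Q : ℕ) (K : ℕ → ℕ → ℝ), (∀ e d, Q < e → 0 < d → K e d = 0) →
      XA Q v w K - XB Q v w K = - ∑ e ∈ Icc 2 Q, K e 1 + 
        (if w ≤ Q then ∑ k ∈ Icc 1 Q, K (r + k * w) w else 0)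
        + ∑ u ∈ U0 Q v w, (∑ k ∈ Icc 1 Q, K (u.2.1 + k * u.2.2.2) u.2.2.2 
          - ∑ k ∈ Icc 1 Q, K ((k + 1) * u.2.2.2 - u.2.1) u.2.2.2) := by
  obtain ⟨r, h1, h2, h3⟩ := endpoint v w hv hvw hc
  refine ⟨r, h1, h2, fun Q K hK => ?_⟩
  rw [XA_eq Q v w hvw K hK, XB_eq Q v w hv hvw K hK, 
    ← h3 Q (fun q q' => ∑ k ∈ Icc 1 Q, K (q + k * q') q')]
  have : (UU Q).filter (fun u => u.2.1 < u.2.2.2 ∧ u.2.2.1 * w ≤ v * u.2.2.2) =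
    U0 Q v w ∪ (UU Q).filter (fun u => u.2.1 < u.2.2.2 ∧ u.2.2.1 * w = v * u.2.2.2) := by
    ext ⟨p, q, p', q'⟩
    simp only [U0, mem_union, mem_filter, le_iff_lt_or_eq]
    tauto
  rw [this, Finset.sum_union, Finset.sum_sub_distrib]
  · unfold U0; ring
  · rw [Finset.disjoint_left]
    rintro ⟨p, q, p', q'⟩
    simp only [U0, mem_filter]
    omega


lemma UUd_sum {Q N : ℕ} (s : Finset (ℕ × ℕ × ℕ × ℕ)) (hs : s ⊆ UU Q)
    (F : ℕ → ℝ) (hF : ∀ d, 0 ≤ F d) (hT : ∀ u ∈ s, u.2.1 ≤ u.2.2.2 ∧ u.2.2.2 ≤ N) :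
    ∑ u ∈ s, F u.2.2.2 ≤ ∑ d ∈ Icc 1 N, d * F d := by
  have h := UU_sum_le s hs ((Icc 1 N ×ˢ Icc 1 N).filter (fun x => x.1 ≤ x.2)) (fun _ d => F d)
    (fun x _ => hF _) (by
      rintro ⟨p, q, p', q'⟩ hu
      have h1 := hT _ hu
      have h2 := hs hu
      rw [mem_UU] at h2
      obtain ⟨_, _, a1, a2⟩ := h2
      have := uni_facts a1 a2
      simp only [mem_filter, mem_product, mem_Icc] at *
      omega)
  refine h.trans (le_of_eq ?_)
  rw [Finset.sum_filter, Finset.sum_product_right]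
  apply Finset.sum_congr rfl
  intro d hd
  rw [mem_Icc] at hd
  simp only
  rw [← Finset.sum_filter, Finset.sum_const, nsmul_eq_mul]
  congr 2
  have : (Icc 1 N).filter (fun x => x ≤ d) = Icc 1 d := by
    ext x; simp only [mem_filter, mem_Icc]; omega
  rw [this]; simp

lemma tele (F : ℕ → ℝ) (hF : Antitone F) (h0 : ∀ e, 0 ≤ F e) (r d J N : ℕ) (hr : r ≤ d) (hJ : J ≤ N) :
    |∑ k ∈ Ioc J N, (F (r + k * d) - F ((k + 1) * d - r))| ≤ F ((J+1) * d) := by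
  have h1 : ∑ k ∈ Ioc J N, (F (k * d) - F ((k + 1) * d)) = F ((J+1)*d) - F ((N+1) * d) := by
    induction N, hJ using Nat.le_induction with
    | base => simp
    | succ n hn ih =>
      rw [Finset.sum_Ioc_succ_top (by omega), ih]; ring
  refine (Finset.abs_sum_le_sum_abs _ _).trans ?_
  refine le_trans (Finset.sum_le_sum (g := fun k => F (k * d) - F ((k + 1) * d)) ?_) ?_
  · intro k _
    have e : (k+1) * d = k * d + d := by ring
    have a1 := hF (show k * d ≤ r + k * d by omega)
    have a2 := hF (show r + k * d ≤ (k+1) * d by omega)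
    have a3 := hF (show k * d ≤ (k+1) * d - r by omega)
    have a4 := hF (show (k+1) * d - r ≤ (k+1) * d by omega)
    rw [abs_le]; constructor <;> linarith
  · rw [h1]; linarith [h0 ((N+1)*d)]

noncomputable def gQ (Q : ℕ) (ρ : ℝ) : ℝ := ∑ k ∈ Icc 1 Q, (1 / ((k:ℝ) + ρ) - 1 / ((k:ℝ) + 1 - ρ))

noncomputable def AA (Q v w : ℕ) (h : ℝ → ℝ) : ℝ :=
  ∑ u ∈ U0 Q v w, h ((u.2.1:ℝ) / u.2.2.2) / (u.2.2.2:ℝ)^2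

lemma F_one (Q r d : ℕ) (hr : 0 < r) (hrd : r < d) (hdQ : d ≤ Q) :
    |(∑ k ∈ Icc 1 Q, (MM Q (r + k * d) d : ℝ) - ∑ k ∈ Icc 1 Q, (MM Q ((k + 1) * d - r) d : ℝ))
      - (Q:ℝ)^2 / 2 * (gQ Q ((r:ℝ)/d) / (d:ℝ)^2)| ≤ 5 * (Q / d * √(Q / d)) := by
  have hd : (0:ℝ) < d := by exact_mod_cast (by omega : 0 < d)
  have hr' : (0:ℝ) < r := by exact_mod_cast hr
  have hrd' : (r:ℝ) < d := by exact_mod_cast hrd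
  set f : ℕ → ℝ := fun e => (Q:ℝ)^2 / (2 * e * d) with hf
  set J := Nat.sqrt (Q / d) with hJ
  set y := √((Q:ℝ) / d) with hy
  have hy0 : 0 ≤ y := Real.sqrt_nonneg _
  have hy2 : y ^ 2 = Q / d := Real.sq_sqrt (by positivity)
  have hJQ : J ≤ Q := (Nat.sqrt_le_self _).trans (Nat.div_le_self _ _)
  have hJy : (J:ℝ) ≤ y := by
    apply Real.le_sqrt_of_sq_le
    rw [le_div_iff₀ hd]
    have h1 : J * J ≤ Q / d := Nat.sqrt_le _
    have h2 := (Nat.le_div_iff_mul_le (by omega : 0 < d)).1 h1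
    rw [sq]; exact_mod_cast h2
  have hJy' : y ≤ J + 1 := by
    rw [hy, Real.sqrt_le_left (by positivity), div_le_iff₀ hd]
    have h1 : Q / d < (J + 1) * (J + 1) := Nat.lt_succ_sqrt _
    have h2 := (Nat.div_lt_iff_lt_mul (by omega : 0 < d)).1 h1
    rw [sq]; exact_mod_cast h2.le
  have hg : (Q:ℝ)^2 / 2 * (gQ Q ((r:ℝ)/d) / (d:ℝ)^2) = ∑ k ∈ Icc 1 Q, (f (r + k * d) - f ((k+1) * d - r)) := by
    unfold gQ
    rw [Finset.sum_div, Finset.mul_sum]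
    apply Finset.sum_congr rfl
    intro k hk
    have e1 : r ≤ (k + 1) * d := hrd.le.trans (Nat.le_mul_of_pos_left _ (by omega))
    simp only [hf]
    push_cast [Nat.cast_sub e1]
    have e2 : (0:ℝ) < (k + 1) * d - r := by
      have : (0:ℝ) ≤ k * d := by positivity
      linarith
    have e3 : (k:ℝ) + r / d = (r + k * d) / d := by field_simp; ring
    have e4 : (k:ℝ) + 1 - r / d = ((k+1) * d - r) / d := by field_simp
    rw [e3, e4]
    have e5 : (0:ℝ) < r + k * d := by positivity
    field_simp
  have anti_f : ∀ a b, 0 < a → a ≤ b → f b ≤ f a := by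
    intro a b ha hab
    simp only [hf]
    have : (0:ℝ) < a := by exact_mod_cast ha
    gcongr
  rw [hg, ← Finset.sum_sub_distrib, show Icc 1 Q = Ioc 0 Q from rfl,
    ← Finset.sum_Ioc_consecutive _ (Nat.zero_le J) hJQ, ← Finset.sum_Ioc_consecutive _ (Nat.zero_le J) hJQ]
  set F : ℕ → ℝ := fun e => (MM Q e d : ℝ) with hFd
  have t1 := tele F (by
      intro a b hab
      simp only [hFd]
      exact_mod_cast MM_anti Q d hab) (fun e => by simp only [hFd]; positivity) r d J Q hrd.le hJQ
  have t2 := tele (fun e => if e = 0 then (Q:ℝ)^2 / d else f e) (by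
      intro a b hab
      simp only
      split_ifs with h1 h2 h2
      · exact le_rfl
      · omega
      · simp only [hf]
        have : (1:ℝ) ≤ b := by exact_mod_cast (by omega : 1 ≤ b)
        gcongr
        nlinarith
      · exact anti_f a b (by omega) hab) (fun e => by split_ifs <;> positivity) r d J Q hrd.le hJQ
  have t2' : |∑ k ∈ Ioc J Q, (f (r + k * d) - f ((k+1) * d - r))| ≤ f ((J+1) * d) := by
    have e0 : (J+1) * d ≠ 0 := (Nat.mul_pos (by omega) (by omega)).ne'
    simp only [e0, if_false] at t2
    convert t2 using 2
    apply Finset.sum_congr rfl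
    intro k _
    have e1 : r + k * d ≠ 0 := by omega
    have e2 : (k+1) * d - r ≠ 0 := by rw [Nat.add_mul]; omega
    simp only [e1, e2, if_false]
  have bf : f ((J+1) * d) ≤ y ^ 3 / 2 := by
    simp only [hf]
    push_cast
    have : (Q:ℝ)^2 / (2 * ((J + 1) * d) * d) = (y^2)^2 / (2 * (J+1)) := by rw [hy2]; field_simp
    rw [this, div_le_iff₀ (by positivity)]
    have := mul_le_mul_of_nonneg_left hJy' (by positivity : 0 ≤ y^3)
    nlinarith
  have bF : F ((J+1) * d) ≤ f ((J+1) * d) := MM_upper Q _ d (Nat.mul_pos (by omega) (by omega)) (by omega)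
  have t3 : |∑ k ∈ Ioc 0 J, (F (r + k * d) - F ((k + 1) * d - r)) - 
      ∑ k ∈ Ioc 0 J, (f (r + k * d) - f ((k+1) * d - r))| ≤ J * (4 * y ^ 2) := by
    rw [← Finset.sum_sub_distrib]
    refine (Finset.abs_sum_le_sum_abs _ _).trans ?_
    have : ∑ k ∈ Ioc 0 J, (4 * y^2) = J * (4 * y^2) := by simp
    rw [← this]
    apply Finset.sum_le_sum
    intro k hk
    rw [mem_Ioc] at hk
    have e : (k+1) * d = k * d + d := by ring
    have e' : d ≤ k * d := Nat.le_mul_of_pos_left _ (by omega)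
    have b1 := MM_approx Q (r + k * d) d (by omega) (by omega)
    have b2 := MM_approx Q ((k+1) * d - r) d (by omega) (by omega)
    have b3 : 2 * (Q:ℝ) / d = 2 * y^2 := by rw [hy2]; ring
    rw [b3] at b1 b2
    simp only [hFd, hf]
    rw [abs_le] at *
    constructor <;> linarith
  have t4 : (J:ℝ) * (4 * y^2) ≤ 4 * y^3 := by
    have := mul_le_mul_of_nonneg_right hJy (by positivity : 0 ≤ 4 * y^2)
    nlinarith
  have t5 : 5 * ((Q:ℝ) / d * y) = 5 * y^3 := by rw [← hy2]; ring
  rw [t5]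
  simp only [hFd] at *
  rw [abs_le] at *
  constructor <;> linarith

lemma sum_inv_sqrt (n : ℕ) : ∑ d ∈ Icc 1 n, 1 / √(d:ℝ) ≤ 2 * √n := by
  induction n with
  | zero => simp
  | succ n ih =>
    rw [Finset.sum_Icc_succ_top (by omega)]
    have h1 : (0:ℝ) < √((n+1:ℕ):ℝ) := Real.sqrt_pos.2 (by positivity)
    have h2 := Real.sqrt_nonneg (n:ℝ)
    have h3 : √((n+1:ℕ):ℝ) ^ 2 = n + 1 := by rw [Real.sq_sqrt (by positivity)]; push_cast; ring
    have h4 : √(n:ℝ) ^ 2 = n := Real.sq_sqrt (by positivity)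
    have : 1 / √((n+1:ℕ):ℝ) ≤ 2 * (√((n+1:ℕ):ℝ) - √(n:ℝ)) := by
      rw [div_le_iff₀ h1]
      nlinarith [sq_nonneg (√((n+1:ℕ):ℝ) - √(n:ℝ))]
    linarith

lemma F_sum (Q v w : ℕ) : 
    |∑ u ∈ U0 Q v w, (∑ k ∈ Icc 1 Q, (MM Q (u.2.1 + k * u.2.2.2) u.2.2.2 : ℝ)
          - ∑ k ∈ Icc 1 Q, (MM Q ((k + 1) * u.2.2.2 - u.2.1) u.2.2.2 : ℝ))
      - (Q:ℝ)^2 / 2 * AA Q v w (gQ Q)| ≤ 10 * (Q:ℝ)^2 := by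
  unfold AA
  rw [Finset.mul_sum, ← Finset.sum_sub_distrib]
  refine (Finset.abs_sum_le_sum_abs _ _).trans ?_
  refine le_trans (Finset.sum_le_sum (g := fun u => 5 * ((Q:ℝ) / u.2.2.2 * √(Q / u.2.2.2))) ?_) ?_
  · rintro ⟨p, q, p', q'⟩ hu
    simp only [U0, mem_filter, mem_UU] at hu
    obtain ⟨⟨h1, h2, a1, a2⟩, h3, h4⟩ := hu
    exact F_one Q q q' (uni_facts a1 a2).1 h3 h2
  · refine (UUd_sum (Q := Q) (N := Q) (U0 Q v w) (Finset.filter_subset _ _) (fun d => 5 * ((Q:ℝ) / d * √(Q / d)))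
      (fun d => by positivity) ?_).trans ?_
    · rintro ⟨p, q, p', q'⟩ hu
      simp only [U0, mem_filter, mem_UU] at hu
      simp only; omega
    · have : ∑ d ∈ Icc 1 Q, (d:ℝ) * (5 * ((Q:ℝ) / d * √(Q / d))) = 5 * Q * √Q * ∑ d ∈ Icc 1 Q, 1 / √(d:ℝ) := by
        rw [Finset.mul_sum]
        apply Finset.sum_congr rfl
        intro d hd
        rw [mem_Icc] at hd
        have : (0:ℝ) < d := by exact_mod_cast hd.1
        rw [Real.sqrt_div (by positivity)]
        field_simp
      rw [this]
      have h1 := mul_le_mul_of_nonneg_left (sum_inv_sqrt Q) (by positivity : 0 ≤ 5 * (Q:ℝ) * √Q)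
      have h2 : √(Q:ℝ) ^ 2 = Q := Real.sq_sqrt (by positivity)
      nlinarith


lemma H_one (Q : ℕ) (hQ : 1 ≤ Q) :
    |∑ e ∈ Icc 2 Q, (MM Q e 1 : ℝ) - (Q:ℝ)^2 / 2 * Real.log Q| ≤ 3 * (Q:ℝ)^2 := by
  have h1 : |∑ e ∈ Icc 2 Q, (MM Q e 1 : ℝ) - ∑ e ∈ Icc 2 Q, (Q:ℝ)^2 / 2 * (1 / (e:ℝ))| ≤ 2 * (Q:ℝ)^2 := by
    rw [← Finset.sum_sub_distrib]
    refine (Finset.abs_sum_le_sum_abs _ _).trans ?_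
    refine (Finset.sum_le_card_nsmul _ _ (2 * (Q:ℝ)) ?_).trans ?_
    · intro e he
      rw [mem_Icc] at he
      have := MM_approx Q e 1 (by omega) (by omega)
      have e1 : (Q:ℝ)^2 / 2 * (1 / (e:ℝ)) = (Q:ℝ)^2 / (2 * e * (1:ℕ)) := by
        push_cast; rw [mul_one_div, div_div]; ring
      rw [e1]; simpa using this
    · rw [nsmul_eq_mul]
      have : ((Icc 2 Q).card : ℝ) ≤ Q := by
        rw [Nat.card_Icc]; exact_mod_cast (by omega : Q + 1 - 2 ≤ Q)
      have := mul_le_mul_of_nonneg_right this (by positivity : 0 ≤ 2 * (Q:ℝ))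
      nlinarith
  have h2 : ∑ e ∈ Icc 2 Q, (1 / (e:ℝ)) = ∑ e ∈ Icc 1 Q, (1 / (e:ℝ)) - 1 := by
    rw [← Finset.insert_Icc_succ_left_eq_Icc hQ, Finset.sum_insert (by simp)]
    simp
  rw [← Finset.mul_sum, h2] at h1
  have h3 := harm_le Q
  have h4 := harm_ge Q
  have h5 : Real.log Q ≤ Real.log (Q+1) := Real.log_le_log (by exact_mod_cast hQ) (by linarith)
  have h6 : |∑ e ∈ Icc 1 Q, (1 / (e:ℝ)) - 1 - Real.log Q| ≤ 1 := by
    rw [abs_le]; constructor <;> linarith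
  have h7 : |(Q:ℝ)^2 / 2 * (∑ e ∈ Icc 1 Q, (1 / (e:ℝ)) - 1 - Real.log Q)| ≤ (Q:ℝ)^2 / 2 * 1 := by
    rw [abs_mul, abs_of_nonneg (by positivity : 0 ≤ (Q:ℝ)^2/2)]
    gcongr
  have : 0 ≤ (Q:ℝ)^2 := by positivity
  rw [abs_le] at *
  constructor <;> linarith

lemma H_two (Q r w : ℕ) (hrw : r < w) (hwQ : w ≤ Q) :
    |∑ k ∈ Icc 1 Q, (MM Q (r + k * w) w : ℝ) - (Q:ℝ)^2 / (2 * (w:ℝ)^2) * Real.log Q| 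
      ≤ 3 * (Q:ℝ)^2 * (1 + Real.log w) := by
  have hw0 : 0 < w := by omega
  have hw : (1:ℝ) ≤ w := by exact_mod_cast hw0
  set N := Q / w with hN
  have hNw : N * w ≤ Q := Nat.div_mul_le_self _ _
  have hNw' : Q < (N + 1) * w := by rw [← Nat.div_lt_iff_lt_mul hw0]; omega
  have hNQ : N ≤ Q := Nat.div_le_self _ _
  have hN1 : 1 ≤ N := by rw [hN, Nat.le_div_iff_mul_le hw0]; omega
  have e0 : ∑ k ∈ Icc 1 Q, (MM Q (r + k * w) w : ℝ) = ∑ k ∈ Icc 1 N, (MM Q (r + k * w) w : ℝ) := by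
    symm
    apply Finset.sum_subset (Finset.Icc_subset_Icc_right hNQ)
    intro k hk hk'
    rw [mem_Icc] at hk hk'
    have : N + 1 ≤ k := by omega
    have := Nat.mul_le_mul_right w this
    rw [MM_zero Q _ w (by omega) hw0]; simp
  rw [e0]
  have h1 : |∑ k ∈ Icc 1 N, (MM Q (r + k * w) w : ℝ) - ∑ k ∈ Icc 1 N, (Q:ℝ)^2 / (2 * (w:ℝ)^2) * (1 / (k + (r:ℝ)/w))| ≤ 2 * (Q:ℝ)^2 := by
    rw [← Finset.sum_sub_distrib]
    refine (Finset.abs_sum_le_sum_abs _ _).trans ?_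
    refine (Finset.sum_le_card_nsmul _ _ (2 * (Q:ℝ)) ?_).trans ?_
    · intro k hk
      rw [mem_Icc] at hk
      have e' : w ≤ k * w := Nat.le_mul_of_pos_left _ (by omega)
      have := MM_approx Q (r + k * w) w hw0 (by omega)
      have hk0 : (0:ℝ) < k := by exact_mod_cast hk.1
      have e1 : (Q:ℝ)^2 / (2 * (w:ℝ)^2) * (1 / (k + (r:ℝ)/w)) = (Q:ℝ)^2 / (2 * ((r + k * w:ℕ):ℝ) * w) := by
        push_cast
        have : (k:ℝ) + r / w = (r + k * w) / w := by field_simp; ring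
        rw [this]; field_simp
      rw [e1]
      refine this.trans (div_le_self (by positivity) hw)
    · rw [nsmul_eq_mul]
      have : ((Icc 1 N).card : ℝ) ≤ Q := by
        rw [Nat.card_Icc]; exact_mod_cast (by omega : N + 1 - 1 ≤ Q)
      have := mul_le_mul_of_nonneg_right this (by positivity : 0 ≤ 2 * (Q:ℝ))
      nlinarith
  rw [← Finset.mul_sum] at h1
  have hr0 : (0:ℝ) ≤ (r:ℝ)/w := by positivity
  have hr1 : (r:ℝ)/w ≤ 1 := by rw [div_le_one (by linarith)]; exact_mod_cast hrw.le
  have u1 : ∑ k ∈ Icc 1 N, (1 / ((k:ℝ) + (r:ℝ)/w)) ≤ ∑ k ∈ Icc 1 N, 1 / (k:ℝ) := by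
    apply Finset.sum_le_sum
    intro k hk
    rw [mem_Icc] at hk
    have hk0 : (0:ℝ) < k := by exact_mod_cast hk.1
    apply one_div_le_one_div_of_le hk0; linarith
  have u2 : ∑ k ∈ Icc 1 N, 1 / (k:ℝ) - 1 ≤ ∑ k ∈ Icc 1 N, (1 / ((k:ℝ) + (r:ℝ)/w)) := by
    have : ∑ k ∈ Icc 1 N, 1 / ((k:ℝ)+1) = ∑ k ∈ Icc 1 N, 1 / (k:ℝ) - 1 + 1 / ((N:ℝ)+1) := by
      clear * -
      induction N with
      | zero => simp
      | succ n ih => 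
        rw [Finset.sum_Icc_succ_top (by omega), Finset.sum_Icc_succ_top (by omega), ih]; push_cast; ring
    have p : 0 < 1 / ((N:ℝ)+1) := by positivity
    have : ∑ k ∈ Icc 1 N, 1 / ((k:ℝ)+1) ≤ ∑ k ∈ Icc 1 N, (1 / ((k:ℝ) + (r:ℝ)/w)) := by
      apply Finset.sum_le_sum
      intro k hk
      rw [mem_Icc] at hk
      have hk0 : (0:ℝ) < k := by exact_mod_cast hk.1
      apply one_div_le_one_div_of_le (by linarith); linarith
    linarith
  have h3 := harm_le N
  have h4 := harm_ge N
  have hQ0 : (0:ℝ) < Q := by exact_mod_cast (by omega : 0 < Q)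
  have h5 : Real.log N ≤ Real.log Q := Real.log_le_log (by exact_mod_cast hN1) (by exact_mod_cast hNQ)
  have h5' : Real.log Q ≤ Real.log (N+1) + Real.log w := by
    rw [← Real.log_mul (by positivity) (by positivity)]
    exact Real.log_le_log hQ0 (by exact_mod_cast hNw'.le)
  have hlw : 0 ≤ Real.log w := Real.log_nonneg hw
  have h6 : |∑ k ∈ Icc 1 N, (1 / ((k:ℝ) + (r:ℝ)/w)) - Real.log Q| ≤ 1 + Real.log w := by
    rw [abs_le]; constructor <;> linarith
  have h8 : (Q:ℝ)^2 / (2 * (w:ℝ)^2) ≤ (Q:ℝ)^2 := by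
    apply div_le_self (by positivity)
    nlinarith
  have h7 : |(Q:ℝ)^2 / (2 * (w:ℝ)^2) * (∑ k ∈ Icc 1 N, (1 / ((k:ℝ) + (r:ℝ)/w)) - Real.log Q)| ≤ (Q:ℝ)^2 * (1 + Real.log w) := by
    rw [abs_mul, abs_of_nonneg (by positivity : 0 ≤ (Q:ℝ)^2 / (2 * (w:ℝ)^2))]
    gcongr
  have : 0 ≤ (Q:ℝ)^2 * Real.log w := by positivity
  rw [abs_le] at *
  constructor <;> linarith

lemma H_all (Q r w : ℕ) (hQ : 1 ≤ Q) (hrw : r < w) :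
    |(-∑ e ∈ Icc 2 Q, (MM Q e 1 : ℝ) + (if w ≤ Q then ∑ k ∈ Icc 1 Q, (MM Q (r + k * w) w : ℝ) else 0))
     + (1 - 1 / (w:ℝ)^2) * ((Q:ℝ)^2 / 2 * Real.log Q)| ≤ 6 * (Q:ℝ)^2 * (1 + Real.log w) := by
  have h1 := H_one Q hQ
  have hw : (1:ℝ) ≤ w := by exact_mod_cast (by omega : 1 ≤ w)
  have hlw : 0 ≤ Real.log w := Real.log_nonneg hw
  have hQ0 : (1:ℝ) ≤ Q := by exact_mod_cast hQ
  have h2 : |(if w ≤ Q then ∑ k ∈ Icc 1 Q, (MM Q (r + k * w) w : ℝ) else 0) - (Q:ℝ)^2 / (2 * (w:ℝ)^2) * Real.log Q| 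
      ≤ 3 * (Q:ℝ)^2 * (1 + Real.log w) := by
    split_ifs with h
    · exact H_two Q r w hrw h
    · have h8 : (Q:ℝ)^2 / (2 * (w:ℝ)^2) ≤ (Q:ℝ)^2 := by
        apply div_le_self (by positivity)
        nlinarith
      have h9 : Real.log Q ≤ Real.log w := Real.log_le_log (by linarith) (by exact_mod_cast (by omega : Q ≤ w))
      have h10 : 0 ≤ Real.log Q := Real.log_nonneg hQ0
      rw [zero_sub, abs_neg, abs_of_nonneg (by positivity)]
      have := mul_le_mul h8 h9 h10 (by positivity)
      have : 0 ≤ (Q:ℝ)^2 * Real.log w := by positivity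
      nlinarith [sq_nonneg (Q:ℝ)]
  have : 0 ≤ (Q:ℝ)^2 * Real.log w := by positivity
  have e : (1 - 1 / (w:ℝ)^2) * ((Q:ℝ)^2 / 2 * Real.log Q) = (Q:ℝ)^2 / 2 * Real.log Q - (Q:ℝ)^2 / (2 * (w:ℝ)^2) * Real.log Q := by
    field_simp
  rw [e]
  rw [abs_le] at *
  constructor <;> linarith


def Hc (Λ : ℝ) (h : ℝ → ℝ) : Prop :=
  (∀ ρ, 0 ≤ ρ → ρ ≤ 1 → h (1 - ρ) = - h ρ) ∧
  (∀ ρ σ, 0 ≤ ρ → ρ ≤ 1 → 0 ≤ σ → σ ≤ 1 → |h ρ - h σ| ≤ Λ * |ρ - σ|)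

lemma Hc.half {Λ : ℝ} {h : ℝ → ℝ} (H : Hc Λ h) : h (1/2) = 0 := by
  have := H.1 (1/2) (by norm_num) (by norm_num)
  norm_num at this ⊢
  linarith

lemma Hc.bound {Λ : ℝ} {h : ℝ → ℝ} (H : Hc Λ h) {ρ : ℝ} (h0 : 0 ≤ ρ) (h1 : ρ ≤ 1) :
    |h ρ| ≤ Λ * |ρ - 1/2| := by
  have := H.2 ρ (1/2) h0 h1 (by norm_num) (by norm_num)
  rwa [H.half, sub_zero] at this

lemma Hc.nonneg {Λ : ℝ} {h : ℝ → ℝ} (H : Hc Λ h) : 0 ≤ Λ := by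
  have := H.bound (ρ := 0) le_rfl (by norm_num)
  norm_num at this
  linarith [abs_nonneg (h 0)]

lemma Hc.bound' {Λ : ℝ} {h : ℝ → ℝ} (H : Hc Λ h) {ρ : ℝ} (h0 : 0 ≤ ρ) (h1 : ρ ≤ 1) :
    |h ρ| ≤ Λ / 2 := by
  refine (H.bound h0 h1).trans ?_
  have : |ρ - 1/2| ≤ 1/2 := by rw [abs_le]; constructor <;> linarith
  have := mul_le_mul_of_nonneg_left this H.nonneg
  linarith

lemma sum_inv_sq (n : ℕ) : ∑ k ∈ Icc 2 n, 1 / (k:ℝ)^2 ≤ (3/4:ℝ) := by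
  rcases Nat.lt_or_ge n 2 with h | h
  · rw [Finset.Icc_eq_empty (by omega)]; norm_num
  have : ∑ k ∈ Icc 2 n, 1 / (k:ℝ)^2 ≤ (3/4:ℝ) - 1 / (n:ℝ) := by
    induction n, h using Nat.le_induction with
    | base => simp; norm_num
    | succ n hn ih =>
      rw [Finset.sum_Icc_succ_top (by omega)]
      have hn0 : (0:ℝ) < n := by exact_mod_cast (by omega : 0 < n)
      have : 1 / ((n+1:ℕ):ℝ)^2 ≤ 1 / n - 1 / ((n+1:ℕ):ℝ) := by
        push_cast
        rw [div_sub_div _ _ (by positivity) (by positivity), div_le_div_iff₀ (by positivity) (by positivity)]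
        nlinarith
      linarith
  have : (0:ℝ) ≤ 1 / n := by positivity
  linarith

lemma sum_inv_sq_tail (m n : ℕ) (hm : 2 ≤ m) : ∑ k ∈ Icc m n, 1 / (k:ℝ)^2 ≤ 1 / ((m:ℝ) - 1) := by
  have hm' : (2:ℝ) ≤ m := by exact_mod_cast hm
  rcases Nat.lt_or_ge n m with h | h
  · rw [Finset.Icc_eq_empty (by omega)]; 
    have : 0 < (m:ℝ) - 1 := by linarith
    simp only [sum_empty]; positivity
  have : ∑ k ∈ Icc m n, 1 / (k:ℝ)^2 ≤ 1 / ((m:ℝ) - 1) - 1 / (n:ℝ) := by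
    induction n, h using Nat.le_induction with
    | base =>
      simp only [Icc_self, sum_singleton]
      have : 0 < (m:ℝ) - 1 := by linarith
      rw [div_sub_div _ _ (by positivity) (by positivity), div_le_div_iff₀ (by positivity) (by positivity)]
      nlinarith
    | succ n hn ih =>
      rw [Finset.sum_Icc_succ_top (by omega)]
      have hn0 : (0:ℝ) < n := by exact_mod_cast (by omega : 0 < n)
      have : 1 / ((n+1:ℕ):ℝ)^2 ≤ 1 / n - 1 / ((n+1:ℕ):ℝ) := by
        push_cast
        rw [div_sub_div _ _ (by positivity) (by positivity), div_le_div_iff₀ (by positivity) (by positivity)]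
        nlinarith
      linarith
  have : (0:ℝ) ≤ 1 / n := by positivity
  linarith

noncomputable def ph (h : ℝ → ℝ) (u : ℝ) : ℝ := h (1 / u) * (1 / u)^2

noncomputable def TT (Q : ℕ) (h : ℝ → ℝ) (ρ : ℝ) : ℝ :=
  ∑ k ∈ Icc 2 Q, (ph h ((k:ℝ) + 1 - ρ) - ph h ((k:ℝ) + ρ))

lemma ph_lip {Λ : ℝ} {h : ℝ → ℝ} (H : Hc Λ h) {k u v : ℝ} (hk : 2 ≤ k) (hu : k ≤ u) (hv : k ≤ v) :
    |ph h u - ph h v| ≤ Λ * |u - v| * (1 / (2 * k^2)) := by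
  unfold ph
  have hΛ := H.nonneg
  set x := 1 / u with hx
  set y := 1 / v with hy
  have u0 : 0 < u := by linarith
  have v0 : 0 < v := by linarith
  have k0 : 0 < k := by linarith
  have x0 : 0 < x := by positivity
  have y0 : 0 < y := by positivity
  have xk : x ≤ 1 / k := one_div_le_one_div_of_le k0 hu
  have yk : y ≤ 1 / k := one_div_le_one_div_of_le k0 hv
  have k2 : 1 / k ≤ 1 / 2 := one_div_le_one_div_of_le (by norm_num) hk
  have hxy : |x - y| = |u - v| * (x * y) := by
    have : x - y = (v - u) * (x * y) := by rw [hx, hy]; field_simp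
    rw [this, abs_mul, abs_of_pos (mul_pos x0 y0), abs_sub_comm]
  have b1 := H.2 x y x0.le (by linarith) y0.le (by linarith)
  have b2 := H.bound y0.le (by linarith : y ≤ 1)
  rw [abs_sub_comm, abs_of_nonneg (by linarith : 0 ≤ 1/2 - y)] at b2
  have e : h x * x^2 - h y * y^2 = (h x - h y) * x^2 + h y * ((x - y) * (x + y)) := by ring
  rw [e]
  refine (abs_add_le _ _).trans ?_
  rw [abs_mul, abs_mul, abs_mul, abs_of_pos (by positivity : 0 < x^2), abs_of_pos (by positivity : 0 < x + y)]
  have c1 : |h x - h y| * x^2 ≤ Λ * |x - y| * x^2 := by gcongr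
  have c2 : |h y| * (|x - y| * (x + y)) ≤ Λ * (1/2 - y) * (|x - y| * (x + y)) := by gcongr
  have c3 : x^2 + (1/2 - y) * (x + y) ≤ 1/2 := by nlinarith [mul_nonneg (by linarith : 0 ≤ 1/2 - x) (by linarith : 0 ≤ 1 + x - y)]
  have c4 : x * y ≤ 1 / k * (1 / k) := mul_le_mul xk yk y0.le (by positivity)
  have c5 : 0 ≤ Λ * |x - y| := by positivity
  have c6 := mul_le_mul_of_nonneg_left c3 c5
  have c7 : Λ * |x - y| ≤ Λ * (|u - v| * (1 / k * (1/k))) := by rw [hxy]; gcongr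
  have c8 : Λ * |u - v| * (1 / (2 * k^2)) = Λ * (|u - v| * (1 / k * (1/k))) * (1/2) := by field_simp
  rw [c8]
  nlinarith

lemma TT_Hc {Λ : ℝ} {h : ℝ → ℝ} (H : Hc Λ h) (Q : ℕ) : Hc (3/4 * Λ) (TT Q h) := by
  constructor
  · intro ρ _ _
    unfold TT
    rw [← Finset.sum_neg_distrib]
    apply Finset.sum_congr rfl
    intro k _
    rw [show (k:ℝ) + 1 - (1 - ρ) = k + ρ by ring, show (k:ℝ) + (1 - ρ) = k + 1 - ρ by ring]; ring
  · intro ρ σ h1 h2 h3 h4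
    unfold TT
    rw [← Finset.sum_sub_distrib]
    refine (Finset.abs_sum_le_sum_abs _ _).trans ?_
    have hΛ := H.nonneg
    have : ∑ k ∈ Icc 2 Q, Λ * |ρ - σ| * (1 / (k:ℝ)^2) ≤ 3/4 * Λ * |ρ - σ| := by
      rw [← Finset.mul_sum]
      have := mul_le_mul_of_nonneg_left (sum_inv_sq Q) (by positivity : 0 ≤ Λ * |ρ - σ|)
      linarith
    refine le_trans (Finset.sum_le_sum ?_) this
    intro k hk
    rw [mem_Icc] at hk
    have hk2 : (2:ℝ) ≤ k := by exact_mod_cast hk.1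
    have a1 := ph_lip H hk2 (u := k + 1 - ρ) (v := k + 1 - σ) (by linarith) (by linarith)
    have a2 := ph_lip H hk2 (u := k + ρ) (v := k + σ) (by linarith) (by linarith)
    rw [show (k:ℝ) + 1 - ρ - (k + 1 - σ) = -(ρ - σ) by ring, abs_neg] at a1
    rw [show (k:ℝ) + ρ - (k + σ) = ρ - σ by ring] at a2
    have e : Λ * |ρ - σ| * (1 / (k:ℝ)^2) = Λ * |ρ - σ| * (1 / (2 * (k:ℝ)^2)) + Λ * |ρ - σ| * (1 / (2 * (k:ℝ)^2)) := by
      field_simp; norm_num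
    rw [e]
    rw [abs_le] at *
    constructor <;> linarith

lemma gQ_Hc (Q : ℕ) : Hc 4 (gQ Q) := by
  constructor
  · intro ρ _ _
    unfold gQ
    rw [← Finset.sum_neg_distrib]
    apply Finset.sum_congr rfl
    intro k _
    rw [show (k:ℝ) + 1 - (1 - ρ) = k + ρ by ring, show (k:ℝ) + (1 - ρ) = k + 1 - ρ by ring]; ring
  · intro ρ σ h1 h2 h3 h4
    unfold gQ
    rw [← Finset.sum_sub_distrib]
    refine (Finset.abs_sum_le_sum_abs _ _).trans ?_
    have l : ∀ k u v : ℝ, 0 < k → k ≤ u → k ≤ v → |1 / u - 1 / v| ≤ |u - v| * (1 / k^2) := by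
      intro k u v hk hu hv
      have u0 : 0 < u := by linarith
      have v0 : 0 < v := by linarith
      have : 1 / u - 1 / v = (v - u) * (1 / (u * v)) := by field_simp
      rw [this, abs_mul, abs_sub_comm, abs_of_pos (by positivity : 0 < 1 / (u * v))]
      gcongr
      nlinarith
    have : ∑ k ∈ Icc 1 Q, 2 * |ρ - σ| * (1 / (k:ℝ)^2) ≤ 4 * |ρ - σ| := by
      rw [← Finset.mul_sum]
      have s1 : ∑ k ∈ Icc 1 Q, (1 / (k:ℝ)^2) ≤ 2 := by
        rcases Nat.eq_zero_or_pos Q with h | h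
        · subst h; simp
        rw [← Finset.insert_Icc_succ_left_eq_Icc h, Finset.sum_insert (by simp)]
        have := sum_inv_sq Q
        norm_num at this ⊢
        linarith
      have := mul_le_mul_of_nonneg_left s1 (by positivity : 0 ≤ 2 * |ρ - σ|)
      linarith
    refine le_trans (Finset.sum_le_sum ?_) this
    intro k hk
    rw [mem_Icc] at hk
    have hk2 : (0:ℝ) < k := by exact_mod_cast hk.1
    have a1 := l k (k + 1 - ρ) (k + 1 - σ) hk2 (by linarith) (by linarith)
    have a2 := l k (k + ρ) (k + σ) hk2 (by linarith) (by linarith)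
    rw [show (k:ℝ) + 1 - ρ - (k + 1 - σ) = -(ρ - σ) by ring, abs_neg] at a1
    rw [show (k:ℝ) + ρ - (k + σ) = ρ - σ by ring] at a2
    rw [abs_le] at *
    constructor <;> linarith


noncomputable def KK (h : ℝ → ℝ) (Q e d : ℕ) : ℝ :=
  if 2 * d < e ∧ e ≤ Q then h ((d:ℝ) / e) / (e:ℝ)^2 else 0

lemma KK_bound {Λ : ℝ} {h : ℝ → ℝ} (H : Hc Λ h) (Q e d : ℕ) : |KK h Q e d| ≤ Λ / 2 * (1 / (e:ℝ)^2) := by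
  have hΛ := H.nonneg
  unfold KK
  split_ifs with h1
  · have e0 : (0:ℝ) < e := by exact_mod_cast (by omega : 0 < e)
    rw [abs_div, abs_of_pos (by positivity : 0 < (e:ℝ)^2), div_eq_mul_one_div]
    gcongr
    apply H.bound' (by positivity)
    rw [div_le_one e0]; exact_mod_cast (by omega : d ≤ e)
  · rw [abs_zero]; positivity

lemma UUd_sum' {Q N : ℕ} (s : Finset (ℕ × ℕ × ℕ × ℕ)) (hs : s ⊆ UU Q)
    (F : ℕ → ℝ) (hF : ∀ d, 0 ≤ F d) (hT : ∀ u ∈ s, u.2.2.2 ≤ u.2.1 ∧ u.2.1 ≤ N) :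
    ∑ u ∈ s, F u.2.1 ≤ ∑ d ∈ Icc 1 N, d * F d := by
  have h := UU_sum_le s hs ((Icc 1 N ×ˢ Icc 1 N).filter (fun x => x.2 ≤ x.1)) (fun d _ => F d)
    (fun x _ => hF _) (by
      rintro ⟨p, q, p', q'⟩ hu
      have h1 := hT _ hu
      have h2 := hs hu
      rw [mem_UU] at h2
      obtain ⟨_, _, a1, a2⟩ := h2
      have := uni_facts a1 a2
      simp only [mem_filter, mem_product, mem_Icc] at *
      omega)
  refine h.trans (le_of_eq ?_)
  rw [Finset.sum_filter, Finset.sum_product]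
  apply Finset.sum_congr rfl
  intro d hd
  rw [mem_Icc] at hd
  simp only
  rw [← Finset.sum_filter, Finset.sum_const, nsmul_eq_mul]
  congr 2
  have : (Icc 1 N).filter (fun x => x ≤ d) = Icc 1 d := by
    ext x; simp only [mem_filter, mem_Icc]; omega
  rw [this]; simp

lemma sum_d_inv (Λ : ℝ) (N : ℕ) (hΛ : 0 ≤ Λ) :
    ∑ d ∈ Icc 1 N, (d:ℝ) * (Λ / 2 * (1 / (d:ℝ)^2)) ≤ Λ / 2 * (1 + Real.log N) := by
  have : ∑ d ∈ Icc 1 N, (d:ℝ) * (Λ / 2 * (1 / (d:ℝ)^2)) = Λ / 2 * ∑ d ∈ Icc 1 N, 1 / (d:ℝ) := by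
    rw [Finset.mul_sum]
    apply Finset.sum_congr rfl
    intro d hd
    rw [mem_Icc] at hd
    have : (0:ℝ) < d := by exact_mod_cast hd.1
    field_simp
  rw [this]
  gcongr
  exact harm_le N

lemma AA_triv {Λ : ℝ} {h : ℝ → ℝ} (H : Hc Λ h) (Q v w : ℕ) :
    |AA Q v w h| ≤ Λ / 2 * (1 + Real.log Q) := by
  have hΛ := H.nonneg
  refine le_trans ?_ (sum_d_inv Λ Q hΛ)
  unfold AA
  refine (Finset.abs_sum_le_sum_abs _ _).trans ?_
  refine le_trans ?_ (UUd_sum (Q := Q) (N := Q) (U0 Q v w) (Finset.filter_subset _ _) (fun d => (Λ / 2 * (1 / (d:ℝ)^2)))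
      (fun d => by positivity) ?_)
  · apply Finset.sum_le_sum
    rintro ⟨p, q, p', q'⟩ hu
    simp only [U0, mem_filter, mem_UU] at hu
    have e0 : (0:ℝ) < q' := by exact_mod_cast (by omega : 0 < q')
    simp only
    rw [abs_div, abs_of_pos (by positivity : 0 < (q':ℝ)^2), div_eq_mul_one_div]
    gcongr
    apply H.bound' (by positivity)
    rw [div_le_one e0]; exact_mod_cast (by omega : q ≤ q')
  · rintro ⟨p, q, p', q'⟩ hu
    simp only [U0, mem_filter, mem_UU] at hu
    simp only; omega

lemma AA_split {Λ : ℝ} {h : ℝ → ℝ} (H : Hc Λ h) (Q v w : ℕ) (hvw : v < w) :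
    AA Q v w h = ∑ u ∈ U0 Q v w, KK h Q u.2.2.2 u.2.1 -
      ∑ u ∈ (UU Q).filter (fun u => u.2.2.2 < u.2.1 ∧ u.1 * w < v * u.2.1), KK h Q u.2.1 u.2.2.2 := by
  unfold AA
  rw [← Finset.sum_filter_add_sum_filter_not (U0 Q v w) (fun u => 2 * u.2.1 ≤ u.2.2.2),
    sub_eq_add_neg]
  congr 1
  · rw [Finset.sum_filter]
    apply Finset.sum_congr rfl
    rintro ⟨p, q, p', q'⟩ hu
    simp only [U0, mem_filter, mem_UU] at hu
    obtain ⟨⟨h1, h2, a1, a2⟩, h3, h4⟩ := hu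
    simp only [KK, h2, and_true]
    rcases lt_trichotomy (2 * q) q' with hc | hc | hc
    · simp [hc, hc.le]
    · have : h ((q:ℝ) / q') = 0 := by
        rw [← hc]
        have : (0:ℝ) < q := by exact_mod_cast (uni_facts a1 a2).1
        push_cast
        rw [show (q:ℝ) / (2 * q) = 1/2 by field_simp]
        exact H.half
      simp [this]
    · simp [not_le.2 hc, not_lt.2 hc.le]
  · rw [← Finset.sum_neg_distrib]
    rw [← Finset.sum_filter_of_ne (s := (UU Q).filter _) (p := fun u => 2 * u.2.2.2 < u.2.1)]
    · apply Finset.sum_nbij' (fun u => (u.2.2.1, u.2.2.2, u.2.2.1 - u.1, u.2.2.2 - u.2.1))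
        (fun u => (u.1 - u.2.2.1, u.2.1 - u.2.2.2, u.1, u.2.1))
      · rintro ⟨p, q, p', q'⟩ hu
        simp only [U0, mem_filter, mem_UU] at hu ⊢
        obtain ⟨⟨⟨h1, h2, a1, a2⟩, h3, h4⟩, h5⟩ := hu
        obtain ⟨f1, f2, f3, f4⟩ := uni_facts a1 a2
        have e1 := uni_le a1 h3
        have e3 : p' < q' := by
          by_contra hc
          have : p' = q' := by omega
          subst this
          have := Nat.mul_le_mul_left p' hvw.le
          nlinarith
        refine ⟨⟨⟨h2, by omega, ?_, ?_⟩, by omega, h4⟩, by omega⟩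
        · zify [e1, h3.le] at a1 ⊢; linear_combination a1
        · zify [e1, h3.le]
          by_contra hc
          push Not at hc
          have hc : (q':ℤ) - p' + 1 ≤ q - p := by omega
          have := mul_le_mul_of_nonneg_right hc (by positivity : (0:ℤ) ≤ q')
          zify at a1 h3 e3
          have : ((q':ℤ) - p') * (q' - q) < 1 := by nlinarith
          have : (1:ℤ) ≤ ((q':ℤ) - p') * (q' - q) := by
            have h1 : (1:ℤ) ≤ q' - p' := by omega
            have h2 : (1:ℤ) ≤ q' - q := by omega
            nlinarith
          omega
      · rintro ⟨p, q, p', q'⟩ hu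
        simp only [U0, mem_filter, mem_UU] at hu ⊢
        obtain ⟨⟨⟨h1, h2, a1, a2⟩, h3, h4⟩, h5⟩ := hu
        obtain ⟨f1, f2, f3, f4⟩ := uni_facts a1 a2
        have e1 : p' ≤ p := by
          by_contra hc
          have hc : p + 1 ≤ p' := by omega
          have := Nat.mul_le_mul hc h3.le
          have := Nat.mul_le_mul_right q hc
          have := Nat.mul_le_mul_left p h3.le
          nlinarith
        refine ⟨⟨⟨by omega, h1, ?_, f4.le⟩, by omega, h4⟩, by omega⟩
        zify [e1, h3.le] at a1 ⊢; linear_combination a1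
      · rintro ⟨p, q, p', q'⟩ hu
        simp only [U0, mem_filter, mem_UU] at hu ⊢
        obtain ⟨⟨⟨h1, h2, a1, a2⟩, h3, h4⟩, h5⟩ := hu
        have e1 := uni_le a1 h3
        simp only [Prod.mk.injEq, and_true]
        omega
      · rintro ⟨p, q, p', q'⟩ hu
        simp only [U0, mem_filter, mem_UU] at hu ⊢
        obtain ⟨⟨⟨h1, h2, a1, a2⟩, h3, h4⟩, h5⟩ := hu
        have e1 : p' ≤ p := by
          by_contra hc
          have hc : p + 1 ≤ p' := by omega
          have := Nat.mul_le_mul hc h3.le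
          have := Nat.mul_le_mul_right q hc
          have := Nat.mul_le_mul_left p h3.le
          nlinarith
        simp only [Prod.mk.injEq, true_and]
        omega
      · rintro ⟨p, q, p', q'⟩ hu
        simp only [U0, mem_filter, mem_UU] at hu ⊢
        obtain ⟨⟨⟨h1, h2, a1, a2⟩, h3, h4⟩, h5⟩ := hu
        have h5' : 2 * (q' - q) < q' ∧ q' ≤ Q := by omega
        simp only [KK, h5', and_self, if_true]
        have e0 : (0:ℝ) < q' := by exact_mod_cast (by omega : 0 < q')
        push_cast [Nat.cast_sub h3.le]
        rw [show ((q':ℝ) - q) / q' = 1 - q / q' by field_simp,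
          H.1 _ (by positivity) (by rw [div_le_one e0]; exact_mod_cast h3.le)]
        ring
    · rintro ⟨p, q, p', q'⟩ hu hne
      by_contra hc
      apply hne
      simp only at hc
      simp [KK, hc]

lemma AA_XAB {Λ : ℝ} {h : ℝ → ℝ} (H : Hc Λ h) (Q v w : ℕ) (hvw : v < w) (hc : Nat.Coprime v w) :
    |AA Q v w h - (XB Q v w (KK h Q) - XA Q v w (KK h Q))| ≤ Λ * (1 + Real.log w) := by
  have hΛ := H.nonneg
  rw [AA_split H Q v w hvw]
  unfold XB XA
  have s1 : ∑ u ∈ (UU Q).filter (fun u => u.2.1 < u.2.2.2 ∧ u.1 * w < v * u.2.1), KK h Q u.2.2.2 u.2.1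
      = ∑ u ∈ U0 Q v w, KK h Q u.2.2.2 u.2.1 + 
      ∑ u ∈ (UU Q).filter (fun u => u.2.1 < u.2.2.2 ∧ u.1 * w < v * u.2.1 ∧ v * u.2.2.2 ≤ u.2.2.1 * w), KK h Q u.2.2.2 u.2.1 := by
    rw [← Finset.sum_filter_add_sum_filter_not _ (fun u => u.2.2.1 * w < v * u.2.2.2)]
    congr 1
    · apply Finset.sum_congr _ (fun _ _ => rfl)
      ext ⟨p, q, p', q'⟩
      simp only [U0, mem_filter, mem_UU]
      constructor
      · tauto
      · rintro ⟨⟨h1, h2, a1, a2⟩, h3, h4⟩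
        exact ⟨⟨⟨h1, h2, a1, a2⟩, h3, uni_order (by omega) a1 a2 h4.le⟩, h4⟩
    · apply Finset.sum_congr _ (fun _ _ => rfl)
      ext ⟨p, q, p', q'⟩
      simp only [mem_filter, not_lt]
      tauto
  have s2 : ∑ u ∈ (UU Q).filter (fun u => u.2.2.2 < u.2.1 ∧ u.1 * w < v * u.2.1), KK h Q u.2.1 u.2.2.2
      = ∑ u ∈ (UU Q).filter (fun u => u.2.2.2 < u.2.1 ∧ u.2.2.1 * w ≤ v * u.2.2.2), KK h Q u.2.1 u.2.2.2 + 
      ∑ u ∈ (UU Q).filter (fun u => u.2.2.2 < u.2.1 ∧ u.1 * w < v * u.2.1 ∧ v * u.2.2.2 < u.2.2.1 * w), KK h Q u.2.1 u.2.2.2 := by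
    rw [← Finset.sum_filter_add_sum_filter_not ((UU Q).filter (fun u => u.2.2.2 < u.2.1 ∧ u.1 * w < v * u.2.1)) (fun u => u.2.2.1 * w ≤ v * u.2.2.2)]
    congr 1
    · apply Finset.sum_congr _ (fun _ _ => rfl)
      ext ⟨p, q, p', q'⟩
      simp only [mem_filter, mem_UU]
      constructor
      · tauto
      · rintro ⟨⟨h1, h2, a1, a2⟩, h3, h4⟩
        exact ⟨⟨⟨h1, h2, a1, a2⟩, h3, uni_order (by omega) a1 a2 h4⟩, h4⟩
    · apply Finset.sum_congr _ (fun _ _ => rfl)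
      ext ⟨p, q, p', q'⟩
      simp only [mem_filter, not_le]
      tauto
  rw [s1, s2]
  have b1 : |∑ u ∈ (UU Q).filter (fun u => u.2.1 < u.2.2.2 ∧ u.1 * w < v * u.2.1 ∧ v * u.2.2.2 ≤ u.2.2.1 * w), KK h Q u.2.2.2 u.2.1|
      ≤ Λ / 2 * (1 + Real.log w) := by
    refine le_trans ?_ (sum_d_inv Λ w hΛ)
    refine (Finset.abs_sum_le_sum_abs _ _).trans ?_
    refine le_trans (Finset.sum_le_sum (fun u _ => KK_bound H Q u.2.2.2 u.2.1)) 
      (UUd_sum (Q := Q) (N := w) _ (Finset.filter_subset _ _) (fun d => (Λ / 2 * (1 / (d:ℝ)^2)))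
      (fun d => by positivity) ?_)
    rintro ⟨p, q, p', q'⟩ hu
    simp only [mem_filter, mem_UU] at hu
    obtain ⟨⟨h1, h2, a1, a2⟩, h3, h4, h5⟩ := hu
    refine ⟨h3.le, ?_⟩
    simp only
    rcases lt_or_eq_of_le h5 with h5 | h5
    · have := straddle_le a1 h4 h5; omega
    · have cop : Nat.Coprime p' q' := by
        have : IsCoprime (p':ℤ) (q':ℤ) := ⟨q, -p, by zify at a1; linear_combination a1⟩
        exact Nat.isCoprime_iff_coprime.1 this
      have : q' ∣ w := cop.symm.dvd_of_dvd_mul_left (h5 ▸ Dvd.intro_left _ rfl)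
      exact Nat.le_of_dvd (by omega) this
  have b2 : |∑ u ∈ (UU Q).filter (fun u => u.2.2.2 < u.2.1 ∧ u.1 * w < v * u.2.1 ∧ v * u.2.2.2 < u.2.2.1 * w), KK h Q u.2.1 u.2.2.2|
      ≤ Λ / 2 * (1 + Real.log w) := by
    refine le_trans ?_ (sum_d_inv Λ w hΛ)
    refine (Finset.abs_sum_le_sum_abs _ _).trans ?_
    refine le_trans (Finset.sum_le_sum (fun u _ => KK_bound H Q u.2.1 u.2.2.2)) 
      (UUd_sum' (Q := Q) (N := w) _ (Finset.filter_subset _ _) (fun d => (Λ / 2 * (1 / (d:ℝ)^2)))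
      (fun d => by positivity) ?_)
    rintro ⟨p, q, p', q'⟩ hu
    simp only [mem_filter, mem_UU] at hu
    obtain ⟨⟨h1, h2, a1, a2⟩, h3, h4, h5⟩ := hu
    have := straddle_le a1 h4 h5
    simp only; omega
  rw [abs_le] at *
  constructor <;> linarith


lemma T_half {Λ : ℝ} {h : ℝ → ℝ} (H : Hc Λ h) (Q s d : ℕ) (hs : 0 < s) (hsd : s < d) (hdQ : d ≤ Q) :
    |∑ k ∈ Icc 1 Q, KK h Q (s + k * d) d - (∑ k ∈ Icc 2 Q, ph h ((k:ℝ) + s / d)) / (d:ℝ)^2| 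
      ≤ 3 / 2 * Λ / (Q * d) := by
  have hΛ := H.nonneg
  have d0 : (0:ℝ) < d := by exact_mod_cast (by omega : 0 < d)
  have Q0 : (0:ℝ) < Q := by exact_mod_cast (by omega : 0 < Q)
  rw [← Finset.insert_Icc_succ_left_eq_Icc (by omega : 1 ≤ Q), Finset.sum_insert (by simp)]
  have k1 : KK h Q (s + 1 * d) d = 0 := by
    unfold KK; rw [if_neg]; omega
  rw [k1, zero_add, Finset.sum_div]
  change |∑ k ∈ Icc 2 Q, KK h Q (s + k * d) d - _| ≤ _
  rw [← Finset.sum_sub_distrib]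
  set m := max 2 (Q / d) with hm
  have hm2 : 2 ≤ m := le_max_left _ _
  have hmQ : Q / d ≤ m := le_max_right _ _
  have step : ∑ k ∈ Icc 2 Q, |KK h Q (s + k * d) d - ph h ((k:ℝ) + s / d) / (d:ℝ)^2| ≤
      ∑ k ∈ Icc 2 Q, if m ≤ k then Λ / (2 * (d:ℝ)^2) * (1 / (k:ℝ)^2) else 0 := by
    apply Finset.sum_le_sum
    intro k hk
    rw [mem_Icc] at hk
    have kd : 2 * d ≤ k * d := Nat.mul_le_mul_right _ hk.1
    have k0 : (2:ℝ) ≤ k := by exact_mod_cast hk.1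
    have hx : (1:ℝ) / (k + s / d) = d / ((s + k * d : ℕ):ℝ) := by
      push_cast
      rw [show (k:ℝ) + s / d = (s + k * d) / d by field_simp; ring]
      field_simp
    have e0 : (0:ℝ) < ((s + k * d : ℕ):ℝ) := by exact_mod_cast (by omega : 0 < s + k * d)
    have hph : ph h ((k:ℝ) + s / d) / (d:ℝ)^2 = h ((d:ℝ) / ((s + k * d : ℕ):ℝ)) / ((s + k * d : ℕ):ℝ)^2 := by
      unfold ph
      rw [hx]; field_simp
    rw [hph]
    by_cases hQ : s + k * d ≤ Q
    · have : 2 * d < s + k * d ∧ s + k * d ≤ Q := by omega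
      simp only [KK, this, and_self, if_true, sub_self, abs_zero]
      split_ifs <;> positivity
    · have hmk : m ≤ k := by
        apply max_le hk.1
        have : Q < (k + 1) * d := by rw [Nat.add_mul]; omega
        have := (Nat.div_lt_iff_lt_mul (by omega : 0 < d)).2 this
        omega
      have : ¬ (2 * d < s + k * d ∧ s + k * d ≤ Q) := by omega
      simp only [KK, this, if_false, zero_sub, abs_neg, hmk, if_true]
      rw [abs_div, abs_of_pos (by positivity : 0 < ((s + k * d : ℕ):ℝ)^2)]
      have b := H.bound' (ρ := (d:ℝ) / ((s + k * d : ℕ):ℝ)) (by positivity) (by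
        rw [div_le_one e0]; exact_mod_cast (by omega : d ≤ s + k * d))
      have c : ((k:ℝ) * d) ^ 2 ≤ ((s + k * d : ℕ):ℝ)^2 := by
        have : (k:ℝ) * d ≤ ((s + k * d : ℕ):ℝ) := by exact_mod_cast (by omega : k * d ≤ s + k * d)
        gcongr
      calc _ ≤ (Λ / 2) / ((k:ℝ) * d) ^ 2 := by gcongr
        _ = _ := by field_simp
  refine (Finset.abs_sum_le_sum_abs _ _).trans (step.trans ?_)
  rw [← Finset.sum_filter]
  have : (Icc 2 Q).filter (fun k => m ≤ k) = Icc m Q := by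
    ext k; simp only [mem_filter, mem_Icc]; omega
  rw [this, ← Finset.mul_sum]
  have t := sum_inv_sq_tail m Q hm2
  have hm2' : (2:ℝ) ≤ m := by exact_mod_cast hm2
  have t2 : 1 / ((m:ℝ) - 1) ≤ 3 * d / Q := by
    rw [div_le_div_iff₀ (by linarith) Q0]
    have h1 : Q < (Q / d + 1) * d := by 
      rw [← Nat.div_lt_iff_lt_mul (by omega)]; omega
    have h2 : Q < (m + 1) * d := h1.trans_le (Nat.mul_le_mul_right _ (by omega))
    have h3 : (Q:ℝ) < (m + 1) * d := by exact_mod_cast h2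
    nlinarith
  calc _ ≤ Λ / (2 * (d:ℝ)^2) * (3 * d / Q) := by gcongr; exact t.trans t2
    _ = _ := by field_simp

lemma T_one {Λ : ℝ} {h : ℝ → ℝ} (H : Hc Λ h) (Q r d : ℕ) (hs : 0 < r) (hsd : r < d) (hdQ : d ≤ Q) :
    |(∑ k ∈ Icc 1 Q, KK h Q (r + k * d) d - ∑ k ∈ Icc 1 Q, KK h Q ((k + 1) * d - r) d) + TT Q h ((r:ℝ) / d) / (d:ℝ)^2|
     ≤ 3 * Λ / (Q * d) := by
  have a1 := T_half H Q r d hs hsd hdQ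
  have a2 := T_half H Q (d - r) d (by omega) (by omega) hdQ
  have d0 : (0:ℝ) < d := by exact_mod_cast (by omega : 0 < d)
  have e1 : ∀ k, (k + 1) * d - r = (d - r) + k * d := by intro k; rw [Nat.add_mul]; omega
  simp only [e1]
  unfold TT
  rw [Finset.sum_sub_distrib, sub_div]
  have e2 : ∀ k : ℕ, (k:ℝ) + ((d - r : ℕ):ℝ) / d = k + 1 - r / d := by
    intro k; push_cast [Nat.cast_sub hsd.le]; field_simp; ring
  simp only [e2] at a2
  have e3 : 3 * Λ / (Q * d) = 3 / 2 * Λ / (Q * d) + 3 / 2 * Λ / (Q * d) := by ring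
  rw [e3]
  rw [abs_le] at *
  constructor <;> linarith

lemma AA_step {Λ : ℝ} {h : ℝ → ℝ} (H : Hc Λ h) (Q v w : ℕ) (hQ : 1 ≤ Q) (hv : 0 < v) (hvw : v < w) (hc : Nat.Coprime v w) :
    |AA Q v w h - AA Q v w (TT Q h)| ≤ 6 * Λ * (1 + Real.log w) := by
  have hΛ := H.nonneg
  have hlw : 0 ≤ Real.log w := Real.log_nonneg (by exact_mod_cast (by omega : 1 ≤ w))
  have b0 := AA_XAB H Q v w hvw hc
  obtain ⟨r, hr0, hr1, hr2⟩ := XAB v w hv hvw hc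
  have b1 := hr2 Q (KK h Q) (by
    intro e d he hd
    unfold KK; rw [if_neg]; omega)
  have c1 : |∑ e ∈ Icc 2 Q, KK h Q e 1| ≤ Λ := by
    refine (Finset.abs_sum_le_sum_abs _ _).trans ?_
    refine (Finset.sum_le_sum (fun e _ => KK_bound H Q e 1)).trans ?_
    rw [← Finset.mul_sum]
    have := mul_le_mul_of_nonneg_left (sum_inv_sq Q) (by positivity : 0 ≤ Λ / 2)
    linarith
  have c2 : |if w ≤ Q then ∑ k ∈ Icc 1 Q, KK h Q (r + k * w) w else 0| ≤ Λ := by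
    split_ifs with hwQ
    · rw [← Finset.insert_Icc_succ_left_eq_Icc (by omega : 1 ≤ Q), Finset.sum_insert (by simp)]
      have k1 : KK h Q (r + 1 * w) w = 0 := by
        unfold KK; rw [if_neg]; omega
      rw [k1, zero_add]
      refine (Finset.abs_sum_le_sum_abs _ _).trans ?_
      have : ∑ k ∈ Icc 2 Q, Λ / 2 * (1 / (k:ℝ)^2) ≤ Λ := by
        rw [← Finset.mul_sum]
        have := mul_le_mul_of_nonneg_left (sum_inv_sq Q) (by positivity : 0 ≤ Λ / 2)
        linarith
      refine le_trans (Finset.sum_le_sum ?_) this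
      intro k hk
      have hk : 2 ≤ k := (mem_Icc.1 hk).1
      refine (KK_bound H Q _ w).trans ?_
      have : (0:ℝ) < k := by exact_mod_cast (by omega : 0 < k)
      have h2 : (k:ℝ) ≤ ((r + k * w : ℕ):ℝ) := by
        have : k ≤ k * w := Nat.le_mul_of_pos_right _ (by omega)
        exact_mod_cast (by omega)
      gcongr
    · simpa using hΛ
  have c3 : |∑ u ∈ U0 Q v w, (∑ k ∈ Icc 1 Q, KK h Q (u.2.1 + k * u.2.2.2) u.2.2.2 
          - ∑ k ∈ Icc 1 Q, KK h Q ((k + 1) * u.2.2.2 - u.2.1) u.2.2.2) + AA Q v w (TT Q h)| ≤ 3 * Λ := by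
    unfold AA
    rw [← Finset.sum_add_distrib]
    refine (Finset.abs_sum_le_sum_abs _ _).trans ?_
    refine le_trans (Finset.sum_le_sum (g := fun u => 3 * Λ / (Q * u.2.2.2)) ?_) ?_
    · rintro ⟨p, q, p', q'⟩ hu
      simp only [U0, mem_filter, mem_UU] at hu
      obtain ⟨⟨h1, h2, a1, a2⟩, h3, h4⟩ := hu
      exact T_one H Q q q' (uni_facts a1 a2).1 h3 h2
    · refine (UUd_sum (Q := Q) (N := Q) (U0 Q v w) (Finset.filter_subset _ _) (fun d => 3 * Λ / (Q * d))
        (fun d => by positivity) ?_).trans ?_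
      · rintro ⟨p, q, p', q'⟩ hu
        simp only [U0, mem_filter, mem_UU] at hu
        simp only; omega
      · have Q0 : (0:ℝ) < Q := by exact_mod_cast hQ
        have : ∑ d ∈ Icc 1 Q, (d:ℝ) * (3 * Λ / (Q * d)) = ∑ d ∈ Icc 1 Q, 3 * Λ / Q := by
          apply Finset.sum_congr rfl
          intro d hd
          rw [mem_Icc] at hd
          have : (0:ℝ) < d := by exact_mod_cast hd.1
          field_simp
        rw [this, Finset.sum_const, nsmul_eq_mul, Nat.card_Icc]
        simp only [Nat.add_sub_cancel]
        apply le_of_eq; field_simp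
  have : 0 ≤ Λ * Real.log w := by positivity
  rw [abs_le] at *
  constructor <;> linarith

lemma AA_ind (Q v w : ℕ) (hQ : 1 ≤ Q) (hv : 0 < v) (hvw : v < w) (hc : Nat.Coprime v w) (n : ℕ) :
    ∀ (Λ : ℝ) (h : ℝ → ℝ), Hc Λ h → |AA Q v w h| ≤ Λ * (24 * (1 + Real.log w) + (3/4)^n * (1 + Real.log Q)) := by
  have hlw : 0 ≤ Real.log w := Real.log_nonneg (by exact_mod_cast (by omega : 1 ≤ w))
  have hlQ : 0 ≤ Real.log Q := Real.log_nonneg (by exact_mod_cast hQ)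
  induction n with
  | zero =>
    intro Λ h H
    have hΛ := H.nonneg
    have := AA_triv H Q v w
    have : 0 ≤ Λ * Real.log w := by positivity
    have : 0 ≤ Λ * Real.log Q := by positivity
    rw [pow_zero]; linarith
  | succ n ih =>
    intro Λ h H
    have a := AA_step H Q v w hQ hv hvw hc
    have b := ih _ _ (TT_Hc H Q)
    have e : Λ * (24 * (1 + Real.log w) + (3/4)^(n+1) * (1 + Real.log Q)) = 
      3/4 * Λ * (24 * (1 + Real.log w) + (3/4)^n * (1 + Real.log Q)) + 6 * Λ * (1 + Real.log w) := by ring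
    rw [e]
    rw [abs_le] at *
    constructor <;> linarith

lemma AA_bound (Q v w : ℕ) (hQ : 1 ≤ Q) (hv : 0 < v) (hvw : v < w) (hc : Nat.Coprime v w) :
    |AA Q v w (gQ Q)| ≤ 96 * (1 + Real.log w) := by
  have h1 : ∀ n : ℕ, |AA Q v w (gQ Q)| ≤ 4 * (24 * (1 + Real.log w) + (3/4)^n * (1 + Real.log Q)) :=
    fun n => AA_ind Q v w hQ hv hvw hc n 4 _ (gQ_Hc Q)
  have t : Filter.Tendsto (fun n : ℕ => 4 * (24 * (1 + Real.log w) + ((3/4:ℝ))^n * (1 + Real.log Q))) Filter.atTop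
      (nhds (4 * (24 * (1 + Real.log w) + 0 * (1 + Real.log Q)))) := by
    apply Filter.Tendsto.const_mul
    apply Filter.Tendsto.const_add
    apply Filter.Tendsto.mul_const
    exact tendsto_pow_atTop_nhds_zero_of_lt_one (by norm_num) (by norm_num)
  have := ge_of_tendsto' t h1
  linarith

lemma SS_bound (Q v w : ℕ) (hQ : 1 ≤ Q) (hv : 0 < v) (hvw : v < w) (hc : Nat.Coprime v w) :
    |SS Q v w + (1 - 1 / (w:ℝ)^2) * ((Q:ℝ)^2 / 2 * Real.log Q)| ≤ 70 * (Q:ℝ)^2 * (1 + Real.log w)^2 := by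
  have hlw : 0 ≤ Real.log w := Real.log_nonneg (by exact_mod_cast (by omega : 1 ≤ w))
  have h1 := SS_main Q v w hvw
  obtain ⟨r, hr0, hr1, hr2⟩ := XAB v w hv hvw hc
  have h2 := hr2 Q (fun e d => (MM Q e d : ℝ)) (fun e d he hd => by
    rw [MM_zero Q e d he.le hd]; simp)
  have h3 := H_all Q r w hQ hr1
  have h4 := F_sum Q v w
  have h5 := AA_bound Q v w hQ hv hvw hc
  have h6 : |(Q:ℝ)^2 / 2 * AA Q v w (gQ Q)| ≤ (Q:ℝ)^2 / 2 * (96 * (1 + Real.log w)) := by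
    rw [abs_mul, abs_of_nonneg (by positivity : 0 ≤ (Q:ℝ)^2 / 2)]; gcongr
  have h7 : (Q:ℝ)^2 * 1 ≤ (Q:ℝ)^2 * (1 + Real.log w)^2 := by gcongr; nlinarith
  have h8 : (Q:ℝ)^2 * (1 + Real.log w) ≤ (Q:ℝ)^2 * (1 + Real.log w)^2 := by gcongr; nlinarith
  rw [abs_le] at *
  constructor <;> linarith


lemma mcf_scale (g : ℕ) (hg : 0 < g) : ∀ d c : ℕ, mcfSteps (g * c) (g * d) = mcfSteps c d := by
  intro d
  induction d using Nat.strong_induction_on with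
  | _ d ih =>
    intro c
    rcases Nat.eq_zero_or_pos d with h | h
    · subst h; rw [mcfSteps, mcfSteps]; simp
    rw [mcfSteps, mcfSteps.eq_def c d]
    have hd : g * d ≠ 0 := (Nat.mul_pos hg h).ne'
    have e : (g * c + g * d - 1) / (g * d) = (c + d - 1) / d := by
      set x := (c + d - 1) / d with hx
      have h1 : x * d ≤ c + d - 1 := Nat.div_mul_le_self _ _
      have h2 : c + d - 1 < (x + 1) * d := by rw [← Nat.div_lt_iff_lt_mul h]; omega
      have h3 : g * (x * d + 1) ≤ g * (c + d) := Nat.mul_le_mul_left _ (by omega)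
      have h4 : g * (c + d) ≤ g * ((x + 1) * d) := Nat.mul_le_mul_left _ (by omega)
      have p : 0 < g * (c + d) := Nat.mul_pos hg (by omega)
      apply Nat.div_eq_of_lt_le
      · have : x * (g * d) = g * (x * d) := by ring
        rw [this]; rw [Nat.mul_add] at h3 h3; omega
      · have : (x + 1) * (g * d) = g * ((x + 1) * d) := by ring
        rw [this, ← Nat.mul_add]; omega
    have e2 : g * d * ((c + d - 1) / d) - g * c = g * (d * ((c + d - 1) / d) - c) := by
      rw [Nat.mul_sub, mul_assoc]
    simp only [hd, h.ne', e, e2, dif_neg, not_false_eq_true]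
    by_cases hr : d * ((c + d - 1) / d) - c = 0
    · simp [hr]
    · have hr' : g * (d * ((c + d - 1) / d) - c) ≠ 0 := (Nat.mul_pos hg (Nat.pos_of_ne_zero hr)).ne'
      rw [if_neg hr', if_neg hr, ih]
      have : d * ((c + d - 1) / d) ≤ c + d - 1 := Nat.mul_div_le _ _
      omega

lemma ff_scale (g a b : ℕ) (hg : 0 < g) : ff (g * a) (g * b) = ff a b := by
  unfold ff
  rw [← Nat.mul_sub, mcf_scale g hg]

lemma mob (T : ℕ → Finset (ℕ × ℕ)) (G : ℕ → ℕ → ℝ)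
    (hT : ∀ Q g a b, 1 ≤ g → ((g * a, g * b) ∈ T Q ↔ (a, b) ∈ T (Q / g)))
    (hG : ∀ g a b, 1 ≤ g → G (g * a) (g * b) = G a b)
    (hpos : ∀ Q a b, (a, b) ∈ T Q → 1 ≤ b ∧ b ≤ Q) (Q : ℕ) :
    ∑ x ∈ (T Q).filter (fun x => Nat.Coprime x.1 x.2), G x.1 x.2 =
      ∑ g ∈ Icc 1 Q, (ArithmeticFunction.moebius g : ℝ) * ∑ x ∈ T (Q / g), G x.1 x.2 := by
  have h1 : ∀ x ∈ T Q, (if Nat.Coprime x.1 x.2 then G x.1 x.2 else 0) =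
      ∑ g ∈ Icc 1 Q, if g ∣ x.1 ∧ g ∣ x.2 then (ArithmeticFunction.moebius g : ℝ) * G x.1 x.2 else 0 := by
    rintro ⟨a, b⟩ hx
    have hb := hpos Q a b hx
    simp only
    rw [← Finset.sum_filter, ← Finset.sum_mul]
    have hf : (Icc 1 Q).filter (fun g => g ∣ a ∧ g ∣ b) = (Nat.gcd a b).divisors := by
      have h0 : Nat.gcd a b ≠ 0 := (Nat.gcd_pos_of_pos_right _ (by omega)).ne'
      ext g
      simp only [mem_filter, mem_Icc, Nat.mem_divisors, Nat.dvd_gcd_iff]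
      constructor
      · rintro ⟨_, h⟩; exact ⟨h, h0⟩
      · rintro ⟨h, _⟩
        exact ⟨⟨Nat.pos_of_dvd_of_pos h.2 (by omega), (Nat.le_of_dvd (by omega) h.2).trans hb.2⟩, h⟩
    rw [hf]
    have hz : ∑ g ∈ (Nat.gcd a b).divisors, ArithmeticFunction.moebius g = if Nat.gcd a b = 1 then 1 else 0 := by
      rw [← ArithmeticFunction.coe_mul_zeta_apply, ArithmeticFunction.moebius_mul_coe_zeta,
        ArithmeticFunction.one_apply]
    have hz' : ∑ g ∈ (Nat.gcd a b).divisors, (ArithmeticFunction.moebius g : ℝ) = if Nat.gcd a b = 1 then 1 else 0 := by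
      exact_mod_cast hz
    rw [hz']
    by_cases hco : Nat.gcd a b = 1
    · have hco' : Nat.Coprime a b := hco
      rw [if_pos hco', if_pos hco, one_mul]
    · have hco' : ¬ Nat.Coprime a b := hco
      rw [if_neg hco', if_neg hco, zero_mul]
  rw [Finset.sum_filter, Finset.sum_congr rfl h1, Finset.sum_comm]
  apply Finset.sum_congr rfl
  intro g hg
  rw [mem_Icc] at hg
  rw [← Finset.sum_filter, Finset.mul_sum]
  symm
  apply Finset.sum_nbij' (fun x => (g * x.1, g * x.2)) (fun x => (x.1 / g, x.2 / g))
  · rintro ⟨a, b⟩ hx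
    simp only [mem_filter]
    exact ⟨(hT Q g a b hg.1).2 hx, Dvd.intro _ rfl, Dvd.intro _ rfl⟩
  · rintro ⟨a, b⟩ hx
    simp only [mem_filter] at hx
    obtain ⟨hx, ⟨a, rfl⟩, ⟨b, rfl⟩⟩ := hx
    simp only [Nat.mul_div_cancel_left _ hg.1]
    exact (hT Q g a b hg.1).1 hx
  · rintro ⟨a, b⟩ hx
    simp only [Nat.mul_div_cancel_left _ hg.1]
  · rintro ⟨a, b⟩ hx
    simp only [mem_filter] at hx
    obtain ⟨hx, ⟨a, rfl⟩, ⟨b, rfl⟩⟩ := hx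
    simp only [Nat.mul_div_cancel_left _ hg.1]
  · rintro ⟨a, b⟩ hx
    simp only
    rw [hG g a b hg.1]


/-- coprime pair version of the difference sum -/
noncomputable def Fs (Q v w : ℕ) : ℝ :=
  ∑ x ∈ (PP Q v w).filter (fun x => Nat.Coprime x.1 x.2), ((ff (x.2 - x.1) x.2 : ℝ) - ff x.1 x.2)

def TR (Q : ℕ) : Finset (ℕ × ℕ) := (Icc 1 Q ×ˢ Icc 1 Q).filter (fun x => x.1 ≤ x.2)
def TS (Q : ℕ) : Finset (ℕ × ℕ) := (Icc 1 Q ×ˢ Icc 1 Q)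

def nn (Q : ℕ) : ℕ := ((TR Q).filter (fun x => Nat.Coprime x.1 x.2)).card

lemma Fs_mob (Q v w : ℕ) : Fs Q v w = ∑ g ∈ Icc 1 Q, (ArithmeticFunction.moebius g : ℝ) * SS (Q / g) v w := by
  unfold Fs SS
  apply mob (fun Q => PP Q v w) (fun a b => (ff (b - a) b : ℝ) - ff a b)
  · intro Q g a b hg
    rw [mem_PP, mem_PP, Nat.le_div_iff_mul_le hg, Nat.le_div_iff_mul_le hg, mul_comm a g, mul_comm b g]
    have e1 : 1 ≤ g * a ↔ 1 ≤ a := by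
      rw [Nat.one_le_iff_ne_zero, Nat.one_le_iff_ne_zero, Nat.mul_ne_zero_iff]; omega
    have e2 : 1 ≤ g * b ↔ 1 ≤ b := by
      rw [Nat.one_le_iff_ne_zero, Nat.one_le_iff_ne_zero, Nat.mul_ne_zero_iff]; omega
    have e3 : g * a * w < v * (g * b) ↔ a * w < v * b := by
      rw [show g * a * w = g * (a * w) by ring, show v * (g * b) = g * (v * b) by ring]
      exact Nat.mul_lt_mul_left hg
    rw [e1, e2, e3]
  · intro g a b hg
    rw [← Nat.mul_sub, ff_scale _ _ _ hg, ff_scale _ _ _ hg]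
  · intro Q a b h
    rw [mem_PP] at h; exact h.1.2

lemma sum_Icc_half (X : ℕ) : ((TR X).card : ℝ) = X * (X + 1) / 2 := by
  have : ((TR X).card : ℝ) = ∑ b ∈ Icc 1 X, (b:ℝ) := by
    unfold TR
    rw [Finset.card_eq_sum_ones, Finset.sum_filter, Finset.sum_product_right]
    push_cast
    apply Finset.sum_congr rfl
    intro d hd
    rw [mem_Icc] at hd
    rw [← Finset.sum_filter]
    have : (Icc 1 X).filter (fun x => x ≤ d) = Icc 1 d := by
      ext x; simp only [mem_filter, mem_Icc]; omega
    rw [this]; simp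
  rw [this]
  clear this
  induction X with
  | zero => simp
  | succ n ih =>
    rw [Finset.sum_Icc_succ_top (by omega), ih]
    push_cast; ring

lemma nn_mob (Q : ℕ) : (nn Q : ℝ) = 
    ∑ g ∈ Icc 1 Q, (ArithmeticFunction.moebius g : ℝ) * (((Q / g : ℕ):ℝ) * (((Q / g : ℕ):ℝ) + 1) / 2) := by
  have h := mob TR (fun _ _ => 1) (by
    intro Q g a b hg
    simp only [TR, mem_filter, mem_product, mem_Icc]
    rw [Nat.le_div_iff_mul_le hg, Nat.le_div_iff_mul_le hg, mul_comm a g, mul_comm b g]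
    have e1 : 1 ≤ g * a ↔ 1 ≤ a := by
      rw [Nat.one_le_iff_ne_zero, Nat.one_le_iff_ne_zero, Nat.mul_ne_zero_iff]; omega
    have e2 : 1 ≤ g * b ↔ 1 ≤ b := by
      rw [Nat.one_le_iff_ne_zero, Nat.one_le_iff_ne_zero, Nat.mul_ne_zero_iff]; omega
    have e3 : g * a ≤ g * b ↔ a ≤ b := Nat.mul_le_mul_left_iff hg
    rw [e1, e2, e3]) (fun _ _ _ _ => rfl) (by
    intro Q a b h
    simp only [TR, mem_filter, mem_product, mem_Icc] at h; omega) Q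
  simp only [Finset.sum_const, nsmul_eq_mul, mul_one] at h
  unfold nn
  rw [h]
  apply Finset.sum_congr rfl
  intro g _
  rw [sum_Icc_half]

lemma abs_mu (g : ℕ) : |(ArithmeticFunction.moebius g : ℝ)| ≤ 1 := by
  have := ArithmeticFunction.abs_moebius_le_one (n := g)
  exact_mod_cast this

lemma nn_lower (Q : ℕ) (hQ : 1 ≤ Q) : (Q:ℝ)^2 / 8 ≤ nn Q := by
  have h := mob TS (fun _ _ => 1) (by
    intro Q g a b hg
    simp only [TS, mem_product, mem_Icc]
    rw [Nat.le_div_iff_mul_le hg, Nat.le_div_iff_mul_le hg, mul_comm a g, mul_comm b g]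
    have e1 : 1 ≤ g * a ↔ 1 ≤ a := by
      rw [Nat.one_le_iff_ne_zero, Nat.one_le_iff_ne_zero, Nat.mul_ne_zero_iff]; omega
    have e2 : 1 ≤ g * b ↔ 1 ≤ b := by
      rw [Nat.one_le_iff_ne_zero, Nat.one_le_iff_ne_zero, Nat.mul_ne_zero_iff]; omega
    rw [e1, e2]) (fun _ _ _ _ => rfl) (by
    intro Q a b h
    simp only [TS, mem_product, mem_Icc] at h; omega) Q
  simp only [Finset.sum_const, nsmul_eq_mul, mul_one] at h
  have c : ((TS Q).filter (fun x => Nat.Coprime x.1 x.2)).card ≤ nn Q + nn Q := by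
    unfold nn
    have : (TS Q).filter (fun x => Nat.Coprime x.1 x.2) ⊆ 
        (TR Q).filter (fun x => Nat.Coprime x.1 x.2) ∪ ((TR Q).filter (fun x => Nat.Coprime x.1 x.2)).image Prod.swap := by
      rintro ⟨a, b⟩ hx
      simp only [TS, TR, mem_filter, mem_product, mem_Icc, mem_union, mem_image, Prod.exists, Prod.swap_prod_mk, Prod.mk.injEq] at hx ⊢
      rcases le_total a b with h | h
      · left; tauto
      · right; exact ⟨b, a, ⟨⟨⟨hx.1.2, hx.1.1⟩, h⟩, hx.2.symm⟩, rfl, rfl⟩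
    exact (card_le_card this).trans ((card_union_le _ _).trans (Nat.add_le_add_left card_image_le _))
  have c' : (((TS Q).filter (fun x => Nat.Coprime x.1 x.2)).card : ℝ) ≤ nn Q + nn Q := by exact_mod_cast c
  rw [h] at c'
  rw [← Finset.insert_Icc_succ_left_eq_Icc hQ, Finset.sum_insert (by simp)] at c'
  have b : |∑ g ∈ Icc 2 Q, (ArithmeticFunction.moebius g : ℝ) * ((TS (Q / g)).card : ℝ)| ≤ (Q:ℝ)^2 * (3/4) := by
    refine (Finset.abs_sum_le_sum_abs _ _).trans ?_
    refine le_trans (Finset.sum_le_sum (g := fun g : ℕ => (Q:ℝ)^2 * (1 / (g:ℝ)^2)) ?_) ?_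
    · intro g hg
      rw [abs_mul]
      have : ((TS (Q / g)).card : ℝ) = ((Q / g : ℕ):ℝ)^2 := by simp [TS, sq]
      rw [this, abs_of_nonneg (sq_nonneg ((Q / g : ℕ):ℝ))]
      have h1 : ((Q / g : ℕ):ℝ) ≤ (Q:ℝ) / g := Nat.cast_div_le
      calc _ ≤ 1 * ((Q:ℝ) / g)^2 := by gcongr; exact abs_mu g
        _ = _ := by rw [div_pow]; ring
    · rw [← Finset.mul_sum]
      gcongr
      exact sum_inv_sq Q
  have t : ((TS (Q / 1)).card : ℝ) = (Q:ℝ)^2 := by simp [TS, sq]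
  rw [t] at c'
  have b' := (abs_le.1 b).1
  have c'' : (Q:ℝ)^2 + ∑ g ∈ Icc 2 Q, (ArithmeticFunction.moebius g : ℝ) * ((TS (Q / g)).card : ℝ) ≤ nn Q + nn Q := by
    simpa using c'
  linarith

lemma sum_g32 (n : ℕ) : ∑ g ∈ Icc 1 n, 1 / ((g:ℝ) * √g) ≤ 3 := by
  rcases Nat.eq_zero_or_pos n with h | h
  · subst h; simp
  have : ∑ g ∈ Icc 1 n, 1 / ((g:ℝ) * √g) ≤ 3 - 2 / √(n:ℝ) := by
    induction n, h using Nat.le_induction with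
    | base => simp; norm_num
    | succ n hn ih =>
      rw [Finset.sum_Icc_succ_top (by omega)]
      have hn0 : (0:ℝ) < n := by exact_mod_cast hn
      have a0 : 0 < √(n:ℝ) := Real.sqrt_pos.2 hn0
      have b0 : 0 < √((n+1:ℕ):ℝ) := Real.sqrt_pos.2 (by positivity)
      have h3 : √((n+1:ℕ):ℝ) ^ 2 = ((n+1:ℕ):ℝ) := Real.sq_sqrt (by positivity)
      have h4 : √(n:ℝ) ^ 2 = n := Real.sq_sqrt (by positivity)
      have h34 : √((n+1:ℕ):ℝ) ^ 2 = √(n:ℝ) ^ 2 + 1 := by rw [h3, h4]; push_cast; ring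
      rw [← h3]
      rw [Real.sqrt_sq b0.le]
      set a := √(n:ℝ)
      set b := √((n+1:ℕ):ℝ)
      have ab : a ≤ b := by nlinarith
      have : 1 / (b^2 * b) ≤ 2 / a - 2 / b := by
        rw [div_sub_div _ _ a0.ne' b0.ne', div_le_div_iff₀ (by positivity) (by positivity)]
        have : (b - a) * (b + a) = 1 := by linarith
        have h5 : 1 * (a * b) * (b + a) ≤ ((2 * b - a * 2) * (b^2 * b)) * (b + a) := by
          have : ((2 * b - a * 2) * (b^2 * b)) * (b + a) = 2 * (b^2 * b) := by linear_combination 2 * (b^2 * b) * this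
          rw [this]
          have := mul_le_mul ab ab a0.le b0.le
          nlinarith [mul_le_mul_of_nonneg_right ab b0.le, mul_le_mul_of_nonneg_right this b0.le, mul_pos a0 b0]
        exact le_of_mul_le_mul_right h5 (by positivity)
      linarith
  have : 0 ≤ 2 / √(n:ℝ) := by positivity
  linarith

lemma log_le_two_sqrt (x : ℝ) (hx : 0 < x) : Real.log x ≤ 2 * √x := by
  have h : Real.log x = 2 * Real.log (√x) := by rw [Real.log_sqrt hx.le]; ring
  rw [h]
  have := Real.log_le_sub_one_of_pos (Real.sqrt_pos.2 hx)
  linarith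

lemma Fs_bound (Q v w : ℕ) (hQ : 1 ≤ Q) (hv : 0 < v) (hvw : v < w) (hc : Nat.Coprime v w) :
    |Fs Q v w + (1 - 1 / (w:ℝ)^2) * Real.log Q * nn Q| ≤ 150 * (Q:ℝ)^2 * (1 + Real.log w)^2 := by
  have hw1 : (1:ℝ) ≤ w := by exact_mod_cast (by omega : 1 ≤ w)
  have hlw : 0 ≤ Real.log w := Real.log_nonneg hw1
  have hQ1 : (1:ℝ) ≤ Q := by exact_mod_cast hQ
  have hlQ : 0 ≤ Real.log Q := Real.log_nonneg hQ1
  set c := 1 - 1 / (w:ℝ)^2 with hcd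
  have c0 : 0 ≤ c := by
    rw [hcd, sub_nonneg, div_le_one (by positivity)]; nlinarith
  have c1 : c ≤ 1 := by
    have : 0 ≤ 1 / (w:ℝ)^2 := by positivity
    linarith
  set E := (1 + Real.log w)^2 with hE
  have E1 : 1 ≤ E := by rw [hE]; nlinarith
  set L := Real.log Q with hL
  rw [Fs_mob, nn_mob, Finset.mul_sum, ← Finset.sum_add_distrib]
  refine (Finset.abs_sum_le_sum_abs _ _).trans ?_
  refine le_trans (Finset.sum_le_sum (g := fun g : ℕ => 70 * (Q:ℝ)^2 * E * (1 / (g:ℝ)^2) + 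
    3 / 2 * (Q:ℝ)^2 * (1 / ((g:ℝ) * √g)) + (Q:ℝ) * L / 2 * (1 / (g:ℝ))) ?_) ?_
  · intro g hg
    rw [mem_Icc] at hg
    set X := Q / g with hX
    have X1 : 1 ≤ X := by rw [hX, Nat.le_div_iff_mul_le hg.1]; omega
    have X1' : (1:ℝ) ≤ X := by exact_mod_cast X1
    have g1 : (1:ℝ) ≤ g := by exact_mod_cast hg.1
    have hXQ : (X:ℝ) ≤ (Q:ℝ) / g := Nat.cast_div_le
    have hlt : Q < (X + 1) * g := by rw [← Nat.div_lt_iff_lt_mul hg.1]; omega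
    have hlt' : (Q:ℝ) ≤ (X + 1) * g := by exact_mod_cast hlt.le
    have b1 := SS_bound X v w X1 hv hvw hc
    have lX : Real.log X ≤ L := Real.log_le_log (by linarith) (by exact_mod_cast Nat.div_le_self _ _)
    have lX' : L ≤ Real.log X + 3 * √g := by
      have h1 : (Q:ℝ) ≤ X * (2 * g) := by nlinarith
      have h2 : L ≤ Real.log (X * (2 * g)) := Real.log_le_log (by linarith) h1
      rw [Real.log_mul (by positivity) (by positivity), Real.log_mul (by norm_num) (by positivity)] at h2
      have h3 := log_le_two_sqrt g (by linarith)
      have h4 : Real.log 2 ≤ 1 := by have := Real.log_two_lt_d9; linarith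
      have h5 : 1 ≤ √(g:ℝ) := by rw [Real.one_le_sqrt]; exact g1
      linarith
    have eq1 : (ArithmeticFunction.moebius g : ℝ) * SS X v w + c * L * ((ArithmeticFunction.moebius g : ℝ) * ((X:ℝ) * (X + 1) / 2))
      = (ArithmeticFunction.moebius g : ℝ) * ((SS X v w + c * ((X:ℝ)^2 / 2 * Real.log X)) + c * ((X:ℝ)^2 / 2 * (L - Real.log X)) + c * (X * L / 2)) := by ring
    rw [eq1, abs_mul]
    have d1 : |SS X v w + c * ((X:ℝ)^2 / 2 * Real.log X)| ≤ 70 * (Q:ℝ)^2 * E * (1 / (g:ℝ)^2) := by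
      refine b1.trans ?_
      calc 70 * (X:ℝ)^2 * E ≤ 70 * ((Q:ℝ)/g)^2 * E := by gcongr
        _ = _ := by rw [div_pow]; ring
    have g0 : (0:ℝ) < g := by linarith
    have sg : 0 < √(g:ℝ) := Real.sqrt_pos.2 g0
    have sg2 : √(g:ℝ)^2 = g := Real.sq_sqrt g0.le
    have d2 : |c * ((X:ℝ)^2 / 2 * (L - Real.log X))| ≤ 3 / 2 * (Q:ℝ)^2 * (1 / ((g:ℝ) * √g)) := by
      have : 0 ≤ L - Real.log X := by linarith
      rw [abs_of_nonneg (by positivity)]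
      calc c * ((X:ℝ)^2 / 2 * (L - Real.log X)) ≤ 1 * (((Q:ℝ)/g)^2 / 2 * (3 * √g)) := by gcongr; linarith
        _ = 3 / 2 * (Q:ℝ)^2 * (√g / (g:ℝ)^2) := by rw [div_pow]; ring
        _ = _ := by
          congr 1
          rw [div_eq_div_iff (by positivity) (by positivity)]
          calc √(g:ℝ) * (g * √g) = g * √(g:ℝ)^2 := by ring
            _ = _ := by rw [sg2]; ring
    have d3 : |c * (X * L / 2)| ≤ (Q:ℝ) * L / 2 * (1 / (g:ℝ)) := by
      rw [abs_of_nonneg (by positivity)]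
      calc c * (X * L / 2) ≤ 1 * ((Q:ℝ) / g * L / 2) := by gcongr
        _ = _ := by ring
    have d4 : |SS X v w + c * ((X:ℝ)^2 / 2 * Real.log X) + c * ((X:ℝ)^2 / 2 * (L - Real.log X)) + c * (X * L / 2)| ≤ 
      70 * (Q:ℝ)^2 * E * (1 / (g:ℝ)^2) + 
    3 / 2 * (Q:ℝ)^2 * (1 / ((g:ℝ) * √g)) + (Q:ℝ) * L / 2 * (1 / (g:ℝ)) := by
      refine (abs_add_le _ _).trans (add_le_add ((abs_add_le _ _).trans (add_le_add d1 d2)) d3)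
    have := mul_le_mul (abs_mu g) d4 (abs_nonneg _) zero_le_one
    linarith
  · rw [Finset.sum_add_distrib, Finset.sum_add_distrib, ← Finset.mul_sum, ← Finset.mul_sum, ← Finset.mul_sum]
    have s1 : ∑ k ∈ Icc 1 Q, (1 / (k:ℝ)^2) ≤ 2 := by
      rw [← Finset.insert_Icc_succ_left_eq_Icc hQ, Finset.sum_insert (by simp)]
      have := sum_inv_sq Q
      norm_num at this ⊢
      linarith
    have s2 := sum_g32 Q
    have s3 := harm_le Q
    have t1 : 70 * (Q:ℝ)^2 * E * ∑ k ∈ Icc 1 Q, (1 / (k:ℝ)^2) ≤ 70 * (Q:ℝ)^2 * E * 2 := by gcongr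
    have t2 : 3 / 2 * (Q:ℝ)^2 * ∑ g ∈ Icc 1 Q, 1 / ((g:ℝ) * √g) ≤ 3 / 2 * (Q:ℝ)^2 * 3 := by gcongr
    have t3 : (Q:ℝ) * L / 2 * ∑ g ∈ Icc 1 Q, 1 / (g:ℝ) ≤ (Q:ℝ) * L / 2 * (1 + L) := by gcongr
    have l1 : L ≤ 2 * √Q := log_le_two_sqrt Q (by linarith)
    have l2 : L ≤ Q := by have := Real.log_le_sub_one_of_pos (by linarith : (0:ℝ) < Q); linarith
    have l3 : √(Q:ℝ)^2 = Q := Real.sq_sqrt (by linarith)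
    have l4 : L * L ≤ 4 * Q := by nlinarith [mul_le_mul l1 l1 hlQ (by positivity)]
    have l5 : (Q:ℝ) * L / 2 * (1 + L) ≤ 5/2 * (Q:ℝ)^2 := by nlinarith
    have l6 : (Q:ℝ)^2 * 1 ≤ (Q:ℝ)^2 * E := by gcongr
    have l7 : 0 ≤ (Q:ℝ)^2 * E := by positivity
    refine (add_le_add (add_le_add t1 t2) (t3.trans l5)).trans ?_
    linarith


lemma mem_farey (Q : ℕ) (x : ℚ) : x ∈ farey Q ↔ 0 ≤ x ∧ x ≤ 1 ∧ x.den ≤ Q := by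
  unfold farey
  simp only [mem_biUnion, mem_Icc, mem_image]
  constructor
  · rintro ⟨w, ⟨hw1, hw⟩, v, ⟨_, hv⟩, rfl⟩
    have hw0 : (0:ℚ) < w := by exact_mod_cast hw1
    refine ⟨by positivity, ?_, ?_⟩
    · rw [div_le_one hw0]; exact_mod_cast hv
    · have h : ((Rat.divInt v w).den : ℤ) ∣ (w:ℤ) := Rat.den_dvd v w
      rw [Rat.divInt_eq_div, Int.cast_natCast, Int.cast_natCast] at h
      have h' := Int.natCast_dvd_natCast.1 h
      exact (Nat.le_of_dvd hw1 h').trans hw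
  · rintro ⟨h0, h1, hd⟩
    have hn : (0:ℤ) ≤ x.num := Rat.num_nonneg.2 h0
    refine ⟨x.den, ⟨x.den_pos, hd⟩, x.num.toNat, ⟨Nat.zero_le _, ?_⟩, ?_⟩
    · have : x.num ≤ x.den := by
        have := Rat.num_le_denom_iff.2 h1
        exact this
      omega
    · have : ((x.num.toNat : ℕ) : ℚ) = ((x.num : ℤ) : ℚ) := by
        have : ((x.num.toNat : ℕ) : ℤ) = x.num := Int.toNat_of_nonneg hn
        exact_mod_cast congrArg (fun z : ℤ => (z:ℚ)) this
      rw [this, Rat.num_div_den]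

lemma rat_nd (a b : ℕ) (hb : 0 < b) (h : Nat.Coprime a b) :
    ((a:ℚ) / (b:ℚ)).num.toNat = a ∧ ((a:ℚ) / (b:ℚ)).den = b := by
  have h1 : (((a:ℤ):ℚ) / ((b:ℤ):ℚ)).num = a :=
    Rat.num_div_eq_of_coprime (by exact_mod_cast hb) (by simpa using h)
  have h2 : ((((a:ℤ):ℚ) / ((b:ℤ):ℚ)).den : ℤ) = b :=
    Rat.den_div_eq_of_coprime (by exact_mod_cast hb) (by simpa using h)
  rw [Int.cast_natCast, Int.cast_natCast] at h1 h2
  refine ⟨by rw [h1]; simp, by exact_mod_cast h2⟩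

lemma rat_eq (x : ℚ) (h0 : 0 ≤ x) : ((x.num.toNat : ℕ):ℚ) / (x.den : ℚ) = x := by
  have : ((x.num.toNat : ℕ) : ℚ) = ((x.num : ℤ) : ℚ) := by
    have : ((x.num.toNat : ℕ) : ℤ) = x.num := Int.toNat_of_nonneg (Rat.num_nonneg.2 h0)
    exact_mod_cast congrArg (fun z : ℤ => (z:ℚ)) this
  rw [this, Rat.num_div_den]

lemma rat_cop (x : ℚ) (h0 : 0 ≤ x) : Nat.Coprime x.num.toNat x.den := by
  have := x.reduced
  have h : x.num.natAbs = x.num.toNat := by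
    have := Rat.num_nonneg.2 h0
    omega
  rwa [h] at this

lemma rat_num_pos (x : ℚ) (h0 : 0 < x) : 1 ≤ x.num.toNat := by
  have := Rat.num_pos.2 h0
  omega

/-- sums over positive Farey fractions as sums over coprime pairs -/
lemma farey_sum (Q : ℕ) (p : ℚ → Prop) [DecidablePred p] (T : Finset (ℕ × ℕ)) (G : ℚ → ℝ)
    (hT : ∀ a b : ℕ, (a, b) ∈ T ↔ ((1 ≤ a ∧ a ≤ b) ∧ b ≤ Q) ∧ p ((a:ℚ) / b)) :
    ∑ x ∈ (farey Q).filter (fun x => 0 < x ∧ p x), G x =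
      ∑ x ∈ T.filter (fun x => Nat.Coprime x.1 x.2), G ((x.1:ℚ) / (x.2:ℚ)) := by
  apply Finset.sum_nbij' (fun x : ℚ => (x.num.toNat, x.den)) (fun x => (x.1:ℚ) / (x.2:ℚ))
  · intro x hx
    simp only [mem_filter, mem_farey] at hx
    obtain ⟨⟨h0, h1, hd⟩, hp, hpx⟩ := hx
    simp only [mem_filter]
    refine ⟨(hT _ _).2 ⟨⟨⟨rat_num_pos x hp, ?_⟩, hd⟩, ?_⟩, rat_cop x h0⟩
    · have : x.num ≤ x.den := Rat.num_le_denom_iff.2 h1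
      omega
    · rw [rat_eq x h0]; exact hpx
  · rintro ⟨a, b⟩ hx
    simp only [mem_filter] at hx
    obtain ⟨hx, hco⟩ := hx
    obtain ⟨⟨⟨h1, h2⟩, h3⟩, h4⟩ := (hT _ _).1 hx
    have hb : (0:ℚ) < b := by exact_mod_cast (by omega : 0 < b)
    have ha : (0:ℚ) < a := by exact_mod_cast h1
    simp only [mem_filter, mem_farey]
    refine ⟨⟨by positivity, ?_, ?_⟩, by positivity, h4⟩
    · rw [div_le_one hb]; exact_mod_cast h2
    · rw [(rat_nd a b (by omega) hco).2]; exact h3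
  · intro x hx
    simp only [mem_filter, mem_farey] at hx
    exact rat_eq x hx.1.1
  · rintro ⟨a, b⟩ hx
    simp only [mem_filter] at hx
    obtain ⟨hx, hco⟩ := hx
    obtain ⟨⟨⟨h1, h2⟩, h3⟩, h4⟩ := (hT _ _).1 hx
    have := rat_nd a b (by omega) hco
    simp only [this]
  · intro x hx
    simp only [mem_filter, mem_farey] at hx
    simp only [rat_eq x hx.1.1]

lemma farey_split (Q : ℕ) (hQ : 1 ≤ Q) (p : ℚ → Prop) [DecidablePred p] (hp : p 0) (G : ℚ → ℝ) :
    ∑ x ∈ (farey Q).filter p, G x = G 0 + ∑ x ∈ (farey Q).filter (fun x => 0 < x ∧ p x), G x := by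
  have : (farey Q).filter p = insert 0 ((farey Q).filter (fun x => 0 < x ∧ p x)) := by
    ext x
    simp only [mem_filter, mem_insert, mem_farey]
    constructor
    · rintro ⟨h, hx⟩
      rcases h.1.eq_or_lt with h0 | h0
      · left; exact h0.symm
      · right; exact ⟨h, h0, hx⟩
    · rintro (rfl | h)
      · refine ⟨⟨le_refl _, zero_le_one, by simpa using hQ⟩, hp⟩
      · exact ⟨h.1, h.2.2⟩
  rw [this, Finset.sum_insert (by simp)]

lemma farey_card (Q : ℕ) (hQ : 1 ≤ Q) : ((farey Q).card : ℝ) = 1 + nn Q := by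
  have h1 := farey_split Q hQ (fun _ => True) trivial (fun _ => 1)
  have h2 := farey_sum Q (fun _ => True) (TR Q) (fun _ => 1) (by
    intro a b
    simp only [TR, mem_filter, mem_product, mem_Icc]
    constructor <;> intro h <;> refine ⟨?_, ?_⟩ <;> first | trivial | omega)
  rw [h2] at h1
  simp only [Finset.filter_true, Finset.sum_const, nsmul_eq_mul, mul_one] at h1
  exact h1

lemma ell_ff (a b : ℕ) (hb : 0 < b) (h : Nat.Coprime a b) : ell ((a:ℚ) / (b:ℚ)) = ff a b := by
  unfold ell ff
  rw [(rat_nd a b hb h).1, (rat_nd a b hb h).2]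

lemma farey_reflect (Q : ℕ) (α : ℚ) :
    ∑ x ∈ (farey Q).filter (fun x => 1 - α < x), (ell x : ℝ) =
      ∑ x ∈ (farey Q).filter (fun x => x < α), (ell (1 - x) : ℝ) := by
  have hden : ∀ x : ℚ, (1 - x).den = x.den := by
    intro x
    simp
  apply Finset.sum_nbij' (fun x : ℚ => 1 - x) (fun x => 1 - x)
  · intro x hx
    simp only [mem_filter, mem_farey, hden] at hx ⊢
    refine ⟨⟨by linarith, by linarith, hx.1.2.2⟩, by linarith⟩
  · intro x hx
    simp only [mem_filter, mem_farey, hden] at hx ⊢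
    refine ⟨⟨by linarith, by linarith, hx.1.2.2⟩, by linarith⟩
  · intro x _; ring
  · intro x _; ring
  · intro x _
    simp only [sub_sub_cancel]

lemma ell_zero : ell 0 = 1 := by
  unfold ell
  rw [mcfSteps]; simp

lemma ell_one : ell 1 = 0 := by
  unfold ell
  rw [mcfSteps]; simp

lemma ell_pos (x : ℚ) (h1 : x < 1) : 1 ≤ ell x := by
  unfold ell
  have h : x.num.toNat < x.den := by
    have : x.num < x.den := Rat.num_lt_denom_iff.2 h1
    have := x.den_pos
    omega
  rw [mcfSteps, dif_neg (by omega)]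
  simp only
  split_ifs <;> omega

lemma diff_eq (Q : ℕ) (hQ : 1 ≤ Q) (α : ℚ) (h0 : 0 < α) (h1 : α < 1) :
    ∑ x ∈ (farey Q).filter (fun x => 1 - α < x), (ell x : ℝ) -
      ∑ x ∈ (farey Q).filter (fun x => x < α), (ell x : ℝ) = Fs Q α.num.toNat α.den - 1 := by
  have hw : (0:ℚ) < α.den := by exact_mod_cast α.den_pos
  have hvw : α.num.toNat < α.den := by
    have : α.num < α.den := Rat.num_lt_denom_iff.2 h1
    have := α.den_pos
    omega
  rw [farey_reflect, ← Finset.sum_sub_distrib,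
    farey_split Q hQ (fun x => x < α) h0 (fun x => (ell (1 - x) : ℝ) - ell x),
    farey_sum Q (fun x => x < α) (PP Q α.num.toNat α.den) (fun x => (ell (1 - x) : ℝ) - ell x)]
  · rw [sub_zero, ell_one, ell_zero]
    unfold Fs
    have : ∀ x ∈ (PP Q α.num.toNat α.den).filter (fun x => Nat.Coprime x.1 x.2),
        ((ell (1 - (x.1:ℚ) / (x.2:ℚ)) : ℝ) - ell ((x.1:ℚ) / (x.2:ℚ))) = (ff (x.2 - x.1) x.2 : ℝ) - ff x.1 x.2 := by
      rintro ⟨a, b⟩ hx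
      rw [mem_filter] at hx
      obtain ⟨hx, hco⟩ := hx
      have hab : a < b := PP_lt hvw hx
      have hco : Nat.Coprime a b := hco
      have hb : (b:ℚ) ≠ 0 := by exact_mod_cast (by omega : b ≠ 0)
      have e : 1 - (a:ℚ) / (b:ℚ) = ((b - a : ℕ):ℚ) / (b:ℚ) := by
        rw [Nat.cast_sub hab.le, sub_div, div_self hb]
      simp only
      rw [e, ell_ff _ _ (by omega) hco, ell_ff _ _ (by omega)]
      have h3 : Nat.Coprime (b - a) (a + (b - a)) := by
        rw [Nat.coprime_add_self_right]
        exact (Nat.coprime_sub_self_left hab.le).2 hco.symm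
      rwa [Nat.add_sub_cancel' hab.le] at h3
    rw [Finset.sum_congr rfl this]
    push_cast; ring
  · intro a b
    rw [mem_PP]
    by_cases hb : 0 < b
    · have hbq : (0:ℚ) < b := by exact_mod_cast hb
      have e : (a:ℚ) / b < α ↔ a * α.den < α.num.toNat * b := by
        conv_lhs => rw [← rat_eq α h0.le]
        rw [div_lt_div_iff₀ hbq hw]
        exact_mod_cast Iff.rfl
      rw [e]
      constructor
      · rintro ⟨h, h'⟩
        have : a < b := PP_lt hvw (mem_PP.2 ⟨h, h'⟩)
        refine ⟨⟨⟨h.1.1, this.le⟩, h.2.2⟩, h'⟩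
      · rintro ⟨h, h'⟩
        refine ⟨⟨⟨h.1.1, by omega⟩, by omega, h.2⟩, h'⟩
    · constructor
      · rintro ⟨h, h'⟩; omega
      · rintro ⟨h, h'⟩; omega

theorem main_aux :
    ∃ C : ℝ, 0 < C ∧ ∀ Q : ℕ, 0 < Q → ∀ α : ℚ, 0 < α → α < 1 →
      (α.den : ℝ) < Real.sqrt Q →
      |(1 / ((farey Q).card : ℝ)) *
          (∑ x ∈ (farey Q).filter (fun x => 1 - α < x), (ell x : ℝ))
        - (1 / ((farey Q).card : ℝ)) *
          (∑ x ∈ (farey Q).filter (fun x => x < α), (ell x : ℝ))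
        + (1 - 1/(α.den : ℝ)^2) * Real.log Q|
      ≤ C * ((ell (1 - α) : ℝ) + (Real.log α.den)^2) := by
  refine ⟨2500, by norm_num, ?_⟩
  intro Q hQ α h0 h1 _
  have hvw : α.num.toNat < α.den := by
    have : α.num < α.den := Rat.num_lt_denom_iff.2 h1
    have := α.den_pos
    omega
  have hB := Fs_bound Q α.num.toNat α.den hQ (rat_num_pos α h0) hvw (rat_cop α h0.le)
  rw [← mul_sub, diff_eq Q hQ α h0 h1, farey_card Q hQ]
  have hN := nn_lower Q hQ
  have hl : (1:ℝ) ≤ ell (1 - α) := by exact_mod_cast ell_pos (1 - α) (by linarith)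
  have hw1 : (1:ℝ) ≤ α.den := by exact_mod_cast α.den_pos
  have hlw : 0 ≤ Real.log α.den := Real.log_nonneg hw1
  have hQ1 : (1:ℝ) ≤ Q := by exact_mod_cast hQ
  have hlQ : 0 ≤ Real.log Q := Real.log_nonneg hQ1
  have l2 : Real.log Q ≤ Q := by have := Real.log_le_sub_one_of_pos (by linarith : (0:ℝ) < Q); linarith
  set c := 1 - 1 / (α.den:ℝ)^2 with hcd
  have c0 : 0 ≤ c := by
    rw [hcd, sub_nonneg, div_le_one (by positivity)]; nlinarith
  have c1 : c ≤ 1 := by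
    have : 0 ≤ 1 / (α.den:ℝ)^2 := by positivity
    linarith
  set F := Fs Q α.num.toNat α.den
  set L := Real.log Q
  set l := Real.log α.den
  set N : ℝ := (nn Q : ℝ)
  have hN0 : (0:ℝ) < 1 + N := by positivity
  have e : 1 / (1 + N) * (F - 1) + c * L = ((F + c * L * N) + (c * L - 1)) / (1 + N) := by
    field_simp; ring
  rw [e, abs_div, abs_of_pos hN0, div_le_iff₀ hN0]
  have hcL : c * L ≤ Q := by nlinarith
  have hcL0 : 0 ≤ c * L := by positivity
  have b1 : |c * L - 1| ≤ Q := by rw [abs_le]; constructor <;> linarith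
  have b2 := abs_add_le (F + c * L * N) (c * L - 1)
  have hE : (1 + l)^2 ≤ 2 * ((ell (1 - α) : ℝ) + l^2) := by nlinarith [sq_nonneg (1 - l)]
  set M := (ell (1 - α) : ℝ) + l^2
  have hM : 1 ≤ M := by have := sq_nonneg l; linarith
  have q1 : 150 * (Q:ℝ)^2 * (1 + l)^2 ≤ 150 * (Q:ℝ)^2 * (2 * M) := by gcongr
  have q2 : (Q:ℝ) ≤ (Q:ℝ)^2 * M := by nlinarith
  have q3 : 2500 * M * ((Q:ℝ)^2 / 8) ≤ 2500 * M * (1 + N) := by gcongr; linarith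
  nlinarith [mul_nonneg (sq_nonneg (Q:ℝ)) (by linarith : 0 ≤ M)]


end Aux

/-- **Theorem 1.3, second formula.** For a reduced rational `α = v/w ∈ (0,1)` with
`w < Q^{1/2}`, the average of `ℓ` over the Farey fractions of order `Q` in `(1-α, 1]`
equals the corresponding average over `[0,α)` minus `(1 - 1/w²) log Q`, up to
`O(ℓ(1-α) + (log w)²)` with an absolute implied constant. -/
theorem average_minus_cf_length_complementary_cut :
    ∃ C : ℝ, 0 < C ∧ ∀ Q : ℕ, 0 < Q → ∀ α : ℚ, 0 < α → α < 1 →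
      (α.den : ℝ) < Real.sqrt Q →
      |(1 / ((farey Q).card : ℝ)) *
          (∑ x ∈ (farey Q).filter (fun x => 1 - α < x), (ell x : ℝ))
        - (1 / ((farey Q).card : ℝ)) *
          (∑ x ∈ (farey Q).filter (fun x => x < α), (ell x : ℝ))
        + (1 - 1/(α.den : ℝ)^2) * Real.log Q|
      ≤ C * ((ell (1 - α) : ℝ) + (Real.log α.den)^2) := by
  exact main_aux
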